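/- Cutting Theorem (existence part of Theorem 2.2). For every δ > 0 there exist constants ρ ≥ 2 and c > 0 such that the following holds for every configuration as in the context, every finite set Q ⊆ C of n points with h_q nonempty for every q ∈ Q, and every real r with 1 ≤ r ≤ n. Let χ be the number of unordered pairs {q, q'} of distinct points of Q with h_q ∩ h_{q'} ≠ ∅, and let k = ⌈log_ρ r⌉. Then there exist finite collections Ξ₀, Ξ₁, …, Ξ_k of pseudo-trapezoids in T such that: (i) Ξ₀ = {T}; (ii) for each 0 ≤ i ≤ k the members of Ξ_i have pairwise disjoint interiors and their union is T; (iii) for each 1 ≤ i ≤ k, every member of Ξ_i is contained in some member of Ξ_{i−1}, and every member of Ξ_{i−1} contains at most c members of Ξ_i; (iv) for each 0 ≤ i ≤ k, the interior of every member of Ξ_i is met by h_q for at most n/ρ^i points q ∈ Q (in particular each member of Ξ_k is crossed by at most n/r of the arcs); and (v) ∑_{i=0}^{k} |Ξ_i| ≤ c·(r^{1+δ} + χ·r²/n²). -/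

import Mathlib

open scoped Classical

noncomputable section

/-- The Euclidean plane. -/
abbrev Plane := EuclideanSpace ℝ (Fin 2)

/-- The side length `1/√2` of the grid cells. -/
def gs : ℝ := 1 / Real.sqrt 2

/-- The closed axis-parallel square with lower-left corner `(x, y)` and side
length `gs = 1/√2`. -/
def Square (x y : ℝ) : Set Plane :=
  {z : Plane | x ≤ z 0 ∧ z 0 ≤ x + gs ∧ y ≤ z 1 ∧ z 1 ≤ y + gs}

/-- The extended cell `T` of the square `C' = [x₀, x₀+gs] × [y₀, y₀+gs]`:
the square with its top edge replaced by the upper arc of the unit circle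
through the two top vertices of `C'` whose center lies below that edge. -/
def ExtCell (x₀ y₀ : ℝ) : Set Plane :=
  {z : Plane | x₀ ≤ z 0 ∧ z 0 ≤ x₀ + gs ∧ y₀ ≤ z 1 ∧
    z 1 ≤ (y₀ + gs - Real.sqrt (7 / 8)) + Real.sqrt (1 - (z 0 - x₀ - gs / 2) ^ 2)}

/-- The upper arc of a point `q`: the part of the unit circle centered at `q`
inside the extended cell. -/
def UpperArc (x₀ y₀ : ℝ) (q : Plane) : Set Plane :=
  {z : Plane | dist z q = 1} ∩ ExtCell x₀ y₀

/-- A pseudo-trapezoid in the extended cell of `C'`: the set of points of the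
extended cell with `u ≤ x ≤ v` lying between the graphs of `g₁` and `g₂`, where
`g₂` is an upper unit-circle arc centered on or below `y = y₀`, and `g₁` is
either the constant `y₀` or such an arc, with `g₁ ≤ g₂` on `[u, v]`. -/
def IsPseudoTrapezoid (x₀ y₀ : ℝ) (σ : Set Plane) : Prop :=
  ∃ (u v : ℝ) (g₁ g₂ : ℝ → ℝ),
    u ≤ v ∧
    (∃ q₂ : Plane, q₂ 1 ≤ y₀ ∧
      ∀ x, g₂ x = q₂ 1 + Real.sqrt (1 - (x - q₂ 0) ^ 2)) ∧
    ((∀ x, g₁ x = y₀) ∨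
      (∃ q₁ : Plane, q₁ 1 ≤ y₀ ∧
        ∀ x, g₁ x = q₁ 1 + Real.sqrt (1 - (x - q₁ 0) ^ 2))) ∧
    (∀ x, u ≤ x → x ≤ v → g₁ x ≤ g₂ x) ∧
    σ = {z ∈ ExtCell x₀ y₀ | u ≤ z 0 ∧ z 0 ≤ v ∧ g₁ (z 0) ≤ z 1 ∧ z 1 ≤ g₂ (z 0)}

/-- The unit circle centered at `q` crosses `σ` if it meets the interior of `σ`. -/
def Crosses (q : Plane) (σ : Set Plane) : Prop :=
  ({z : Plane | dist z q = 1} ∩ interior σ).Nonempty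

/-- The number of members of the collection `Π` crossed by the unit circle
centered at `q`. -/
def crossCount (q : Plane) (Pi : Finset (Set Plane)) : ℕ :=
  {σ : Set Plane | σ ∈ Pi ∧ Crosses q σ}.ncard

namespace Cut

/-- A finite family `Q` of curves taken from a family `G` of graphs over a floor `y₀`. -/
structure ArcSys (ι : Type) where
  G : ι → ℝ → ℝ
  y₀ : ℝ
  Q : Finset ι
  cont : ∀ i, Continuous (G i)
  ord : ∀ i j, {x | y₀ < G i x ∧ G i x < G j x}.OrdConnected
  uniq : ∀ i j, i ≠ j → ∀ x y, y₀ < G i x → y₀ < G i y → G i x = G j x → G i y = G j y → x = y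

/-- A combinatorial cell. -/
structure Cell (ι : Type) where
  u : ℝ
  v : ℝ
  lo : Option ι
  hi : ι

variable {ι : Type} (A : ArcSys ι)

/-- The lower boundary function. -/
def low (o : Option ι) (x : ℝ) : ℝ :=
  match o with
  | none => A.y₀
  | some i => A.G i x

/-- The set of abscissae where the curve `q` lies inside the cell. -/
def J (σ : Cell ι) (q : ι) : Set ℝ :=
  {x | σ.u < x ∧ x < σ.v ∧ low A σ.lo x < A.G q x ∧ A.G q x < A.G σ.hi x}

structure Valid (σ : Cell ι) : Prop where
  uv : σ.u < σ.v
  lo_hi : ∀ x, σ.u < x → x < σ.v → low A σ.lo x < A.G σ.hi x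
  floor : ∀ i, σ.lo = some i → ∀ x, σ.u < x → x < σ.v → A.y₀ < A.G i x

def Spans (σ : Cell ι) (c : ι) : Prop := ∀ x, σ.u < x → x < σ.v → x ∈ J A σ c

def lft (σ : Cell ι) (w : ℝ) : Cell ι := { σ with v := w }
def rgt (σ : Cell ι) (w : ℝ) : Cell ι := { σ with u := w }
def bot (σ : Cell ι) (c : ι) : Cell ι := { σ with hi := c }
def upp (σ : Cell ι) (c : ι) : Cell ι := { σ with lo := some c }

/-- Guillotine subdivisions of a cell. -/
inductive Sub : Cell ι → List (Cell ι) → Prop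
  | refl (σ : Cell ι) : Sub σ [σ]
  | vs (σ : Cell ι) (w : ℝ) (L₁ L₂ : List (Cell ι)) : σ.u < w → w < σ.v →
      Sub (lft σ w) L₁ → Sub (rgt σ w) L₂ → Sub σ (L₁ ++ L₂)
  | hs (σ : Cell ι) (c : ι) (L₁ L₂ : List (Cell ι)) : Spans A σ c →
      Sub (bot σ c) L₁ → Sub (upp σ c) L₂ → Sub σ (L₁ ++ L₂)

lemma quantile {α : Type} (s : Finset α) (f : α → ℝ) (j : ℕ) (hj : j < s.card) :
    ∃ i ∈ s, (s.filter (fun a => f a < f i)).card ≤ j ∧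
      (s.filter (fun a => f i < f a)).card + (j + 1) ≤ s.card := by
  have hs : s.Nonempty := Finset.card_pos.mp (by omega)
  set P := s.filter (fun i => j + 1 ≤ (s.filter (fun a => f a ≤ f i)).card) with hP
  have hPne : P.Nonempty := by
    obtain ⟨m, hm, hmax⟩ := Finset.exists_max_image s f hs
    refine ⟨m, ?_⟩
    rw [hP, Finset.mem_filter]
    refine ⟨hm, ?_⟩
    rw [Finset.filter_true_of_mem (fun a ha => hmax a ha)]
    omega
  obtain ⟨i, hi, hmin⟩ := Finset.exists_min_image P f hPne
  rw [hP, Finset.mem_filter] at hi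
  refine ⟨i, hi.1, ?_, ?_⟩
  · by_contra hcon
    push Not at hcon
    have hne : (s.filter (fun a => f a < f i)).Nonempty := Finset.card_pos.mp (by omega)
    obtain ⟨k, hk, hkmax⟩ := Finset.exists_max_image _ f hne
    have hk' := Finset.mem_filter.mp hk
    have : k ∈ P := by
      rw [hP, Finset.mem_filter]
      refine ⟨hk'.1, le_trans (Nat.succ_le_of_lt hcon) (Finset.card_le_card ?_)⟩
      intro a ha
      exact Finset.mem_filter.mpr ⟨(Finset.mem_filter.mp ha).1, hkmax a ha⟩
    have := hmin k this
    linarith [hk'.2]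
  · have h := Finset.card_filter_add_card_filter_not (s := s) (fun a => f a ≤ f i)
    simp only [not_le] at h
    omega

variable {A}

lemma low_cont (o : Option ι) : Continuous (low A o) := by
  cases o with
  | none => exact continuous_const
  | some i => exact A.cont i

lemma J_open (σ : Cell ι) (q : ι) : IsOpen (J A σ q) := by
  have h1 := low_cont (A := A) σ.lo
  have h2 := A.cont q
  have h3 := A.cont σ.hi
  exact (isOpen_lt continuous_const continuous_id).inter
    ((isOpen_lt continuous_id continuous_const).inter
      ((isOpen_lt h1 h2).inter (isOpen_lt h2 h3)))

lemma Valid.low_ge {σ : Cell ι} (h : Valid A σ) {x : ℝ} (h1 : σ.u < x) (h2 : x < σ.v) :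
    A.y₀ ≤ low A σ.lo x := by
  rcases hl : σ.lo with _ | i
  · exact le_rfl
  · exact (h.floor i hl x h1 h2).le

lemma Valid.J_gt {σ : Cell ι} (h : Valid A σ) {q : ι} {x : ℝ} (hx : x ∈ J A σ q) :
    A.y₀ < A.G q x := lt_of_le_of_lt (h.low_ge hx.1 hx.2.1) hx.2.2.1

lemma Valid.J_ord {σ : Cell ι} (h : Valid A σ) (q : ι) : (J A σ q).OrdConnected := by
  refine ⟨fun x hx y hy z hz => ?_⟩
  have hzu : σ.u < z := lt_of_lt_of_le hx.1 hz.1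
  have hzv : z < σ.v := lt_of_le_of_lt hz.2 hy.2.1
  have h2 := (A.ord q σ.hi).out (x := x) ⟨h.J_gt hx, hx.2.2.2⟩ (y := y) ⟨h.J_gt hy, hy.2.2.2⟩ hz
  refine ⟨hzu, hzv, ?_, h2.2⟩
  rcases hl : σ.lo with _ | i
  · exact h2.1
  · have hx3 := hx.2.2.1
    have hy3 := hy.2.2.1
    rw [hl] at hx3 hy3
    exact ((A.ord i q).out (x := x) ⟨h.floor i hl x hx.1 hx.2.1, hx3⟩ (y := y)
      ⟨h.floor i hl y hy.1 hy.2.1, hy3⟩ hz).2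

lemma Valid.J_Ioo {σ : Cell ι} (h : Valid A σ) {q : ι} (hne : (J A σ q).Nonempty) :
    ∃ l r, l < r ∧ σ.u ≤ l ∧ r ≤ σ.v ∧ J A σ q = Set.Ioo l r := by
  have hb : BddBelow (J A σ q) := ⟨σ.u, fun x hx => hx.1.le⟩
  have ha : BddAbove (J A σ q) := ⟨σ.v, fun x hx => hx.2.1.le⟩
  have hc : IsConnected (J A σ q) := ⟨hne, (h.J_ord q).isPreconnected⟩
  have hsub := hc.Ioo_csInf_csSup_subset hb ha
  have hsup : J A σ q ⊆ Set.Ioo (sInf (J A σ q)) (sSup (J A σ q)) := by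
    intro x hx
    obtain ⟨ε, hε, hball⟩ := Metric.isOpen_iff.mp (J_open (A := A) σ q) x hx
    have h1 : x - ε / 2 ∈ J A σ q := hball (by
      rw [Metric.mem_ball, Real.dist_eq, abs_lt]; constructor <;> linarith)
    have h2 : x + ε / 2 ∈ J A σ q := hball (by
      rw [Metric.mem_ball, Real.dist_eq, abs_lt]; constructor <;> linarith)
    constructor
    · linarith [csInf_le hb h1]
    · linarith [le_csSup ha h2]
  obtain ⟨x, hx⟩ := hne
  have hx' := hsup hx
  exact ⟨_, _, hx'.1.trans hx'.2, le_csInf ⟨x, hx⟩ (fun y hy => hy.1.le),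
    csSup_le ⟨x, hx⟩ (fun y hy => hy.2.1.le), Set.Subset.antisymm hsup hsub⟩

/-! ### Splits preserve validity -/

lemma Valid.lft {σ : Cell ι} (h : Valid A σ) {w : ℝ} (h1 : σ.u < w) (h2 : w < σ.v) :
    Valid A (lft σ w) :=
  ⟨h1, fun x a b => h.lo_hi x a (lt_trans b h2), fun i hi x a b => h.floor i hi x a (lt_trans b h2)⟩

lemma Valid.rgt {σ : Cell ι} (h : Valid A σ) {w : ℝ} (h1 : σ.u < w) (h2 : w < σ.v) :
    Valid A (rgt σ w) :=
  ⟨h2, fun x a b => h.lo_hi x (lt_trans h1 a) b, fun i hi x a b => h.floor i hi x (lt_trans h1 a) b⟩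

lemma Valid.bot {σ : Cell ι} (h : Valid A σ) {c : ι} (hc : Spans A σ c) :
    Valid A (bot σ c) :=
  ⟨h.uv, fun x a b => (hc x a b).2.2.1, fun i hi x a b => h.floor i hi x a b⟩

lemma Valid.upp {σ : Cell ι} (h : Valid A σ) {c : ι} (hc : Spans A σ c) :
    Valid A (upp σ c) :=
  ⟨h.uv, fun x a b => (hc x a b).2.2.2, fun i hi x a b => by
    have : c = i := Option.some.inj hi
    subst this
    exact h.J_gt (hc x a b)⟩

lemma J_lft (σ : Cell ι) (q : ι) {w : ℝ} (h2 : w < σ.v) :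
    J A (lft σ w) q = J A σ q ∩ Set.Iio w := by
  ext x
  constructor
  · rintro ⟨a, b, c⟩; exact ⟨⟨a, lt_trans b h2, c⟩, b⟩
  · rintro ⟨⟨a, b, c⟩, d⟩; exact ⟨a, d, c⟩

lemma J_rgt (σ : Cell ι) (q : ι) {w : ℝ} (h1 : σ.u < w) :
    J A (rgt σ w) q = J A σ q ∩ Set.Ioi w := by
  ext x
  constructor
  · rintro ⟨a, b, c⟩; exact ⟨⟨lt_trans h1 a, b, c⟩, a⟩
  · rintro ⟨⟨a, b, c⟩, d⟩; exact ⟨d, b, c⟩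

lemma J_bot (σ : Cell ι) (q : ι) {c : ι} (hc : Spans A σ c) :
    J A (bot σ c) q = J A σ q ∩ {x | A.G q x < A.G c x} := by
  ext x
  constructor
  · rintro ⟨a, b, d, e⟩; exact ⟨⟨a, b, d, lt_trans e (hc x a b).2.2.2⟩, e⟩
  · rintro ⟨⟨a, b, d, e⟩, f⟩; exact ⟨a, b, d, f⟩

lemma J_upp (σ : Cell ι) (q : ι) {c : ι} (hc : Spans A σ c) :
    J A (upp σ c) q = J A σ q ∩ {x | A.G c x < A.G q x} := by
  ext x
  constructor
  · rintro ⟨a, b, d, e⟩; exact ⟨⟨a, b, lt_trans (hc x a b).2.2.1 d, e⟩, d⟩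
  · rintro ⟨⟨a, b, d, e⟩, f⟩; exact ⟨a, b, f, e⟩

/-! ### Counting quantities -/

variable (A)

/-- curves crossing the cell -/
def M (σ : Cell ι) : Finset ι := A.Q.filter (fun q => (J A σ q).Nonempty)

/-- position of an end of an interval -/
def pos (σ : Cell ι) (e : ι × Bool) : ℝ :=
  if e.2 then sSup (J A σ e.1) else sInf (J A σ e.1)

def IsEnd (σ : Cell ι) (e : ι × Bool) : Prop :=
  (J A σ e.1).Nonempty ∧ σ.u < pos A σ e ∧ pos A σ e < σ.v

def Eset (σ : Cell ι) : Finset (ι × Bool) :=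
  (A.Q ×ˢ Finset.univ).filter (IsEnd A σ)

def Meets (σ : Cell ι) (q q' : ι) : Prop := q ≠ q' ∧ ∃ x ∈ J A σ q, A.G q x = A.G q' x

def Xset (σ : Cell ι) : Finset (ι × ι) := (A.Q ×ˢ A.Q).filter (fun p => Meets A σ p.1 p.2)

def crossing (σ : Cell ι) (c : ι) : Finset ι := A.Q.filter (fun q => Meets A σ c q)

variable {A}

lemma sum_crossing (σ : Cell ι) : ∑ c ∈ A.Q, (crossing A σ c).card = (Xset A σ).card := by
  rw [Xset, Finset.card_filter, Finset.sum_product]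
  exact Finset.sum_congr rfl (fun c _ => by rw [crossing, Finset.card_filter])

lemma Meets.mono {σ τ : Cell ι} (h : ∀ q, J A τ q ⊆ J A σ q) {q q' : ι} (hm : Meets A τ q q') :
    Meets A σ q q' := ⟨hm.1, let ⟨x, hx, he⟩ := hm.2; ⟨x, h q hx, he⟩⟩

lemma M_mono {σ τ : Cell ι} (h : ∀ q, J A τ q ⊆ J A σ q) : M A τ ⊆ M A σ := by
  intro q hq
  have := Finset.mem_filter.mp hq
  exact Finset.mem_filter.mpr ⟨this.1, this.2.mono (h q)⟩

lemma Xset_mono {σ τ : Cell ι} (h : ∀ q, J A τ q ⊆ J A σ q) : Xset A τ ⊆ Xset A σ := by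
  intro q hq
  have := Finset.mem_filter.mp hq
  exact Finset.mem_filter.mpr ⟨this.1, this.2.mono h⟩

lemma crossing_mono {σ τ : Cell ι} (h : ∀ q, J A τ q ⊆ J A σ q) (c : ι) :
    crossing A τ c ⊆ crossing A σ c := by
  intro q hq
  have := Finset.mem_filter.mp hq
  exact Finset.mem_filter.mpr ⟨this.1, this.2.mono h⟩

lemma lft_sub {σ : Cell ι} {w : ℝ} (h2 : w < σ.v) (q : ι) : J A (lft σ w) q ⊆ J A σ q := by
  rw [J_lft σ q h2]; exact Set.inter_subset_left
lemma rgt_sub {σ : Cell ι} {w : ℝ} (h1 : σ.u < w) (q : ι) : J A (rgt σ w) q ⊆ J A σ q := by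
  rw [J_rgt σ q h1]; exact Set.inter_subset_left
lemma bot_sub {σ : Cell ι} {c : ι} (hc : Spans A σ c) (q : ι) : J A (bot σ c) q ⊆ J A σ q := by
  rw [J_bot σ q hc]; exact Set.inter_subset_left
lemma upp_sub {σ : Cell ι} {c : ι} (hc : Spans A σ c) (q : ι) : J A (upp σ c) q ⊆ J A σ q := by
  rw [J_upp σ q hc]; exact Set.inter_subset_left

lemma Sub.sub {σ : Cell ι} {L : List (Cell ι)} (h : Sub A σ L) :
    ∀ τ ∈ L, ∀ q, J A τ q ⊆ J A σ q := by
  induction h with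
  | refl σ => intro τ hτ q; rw [List.mem_singleton.mp hτ]
  | vs σ w L₁ L₂ h1 h2 _ _ ih1 ih2 =>
    intro τ hτ q
    rcases List.mem_append.mp hτ with h | h
    · exact (ih1 τ h q).trans (lft_sub h2 q)
    · exact (ih2 τ h q).trans (rgt_sub h1 q)
  | hs σ c L₁ L₂ hc _ _ ih1 ih2 =>
    intro τ hτ q
    rcases List.mem_append.mp hτ with h | h
    · exact (ih1 τ h q).trans (bot_sub hc q)
    · exact (ih2 τ h q).trans (upp_sub hc q)

lemma Sub.valid {σ : Cell ι} {L : List (Cell ι)} (h : Sub A σ L) (hv : Valid A σ) :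
    ∀ τ ∈ L, Valid A τ := by
  induction h with
  | refl σ => intro τ hτ; rw [List.mem_singleton.mp hτ]; exact hv
  | vs σ w L₁ L₂ h1 h2 _ _ ih1 ih2 =>
    intro τ hτ
    rcases List.mem_append.mp hτ with h | h
    · exact ih1 (hv.lft h1 h2) τ h
    · exact ih2 (hv.rgt h1 h2) τ h
  | hs σ c L₁ L₂ hc _ _ ih1 ih2 =>
    intro τ hτ
    rcases List.mem_append.mp hτ with h | h
    · exact ih1 (hv.bot hc) τ h
    · exact ih2 (hv.upp hc) τ h

lemma Sub.flatMap {σ : Cell ι} {L : List (Cell ι)} (h : Sub A σ L) (F : Cell ι → List (Cell ι))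
    (hF : ∀ τ ∈ L, Sub A τ (F τ)) : Sub A σ (L.flatMap F) := by
  induction h with
  | refl σ => simpa using hF σ (by simp)
  | vs σ w L₁ L₂ h1 h2 _ _ ih1 ih2 =>
    rw [List.flatMap_append]
    exact Sub.vs σ w _ _ h1 h2 (ih1 (fun τ hτ => hF τ (List.mem_append_left _ hτ)))
      (ih2 (fun τ hτ => hF τ (List.mem_append_right _ hτ)))
  | hs σ c L₁ L₂ hc _ _ ih1 ih2 =>
    rw [List.flatMap_append]
    exact Sub.hs σ c _ _ hc (ih1 (fun τ hτ => hF τ (List.mem_append_left _ hτ)))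
      (ih2 (fun τ hτ => hF τ (List.mem_append_right _ hτ)))

lemma length_flatMap_le (L : List (Cell ι)) (F : Cell ι → List (Cell ι)) (f : Cell ι → ℝ)
    (h : ∀ τ ∈ L, ((F τ).length : ℝ) ≤ f τ) : ((L.flatMap F).length : ℝ) ≤ (L.map f).sum := by
  induction L with
  | nil => simp
  | cons a L ih =>
    simp only [List.flatMap_cons, List.length_append, List.map_cons, List.sum_cons, Nat.cast_add]
    exact add_le_add (h a (by simp)) (ih (fun τ hτ => h τ (by simp [hτ])))

lemma Sub.bind {σ : Cell ι} {L : List (Cell ι)} (h : Sub A σ L) (P : Cell ι → Prop)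
    (f : Cell ι → ℝ)
    (hF : ∀ τ ∈ L, ∃ L', Sub A τ L' ∧ (∀ κ ∈ L', P κ) ∧ (L'.length : ℝ) ≤ f τ) :
    ∃ L', Sub A σ L' ∧ (∀ κ ∈ L', P κ) ∧ (L'.length : ℝ) ≤ (L.map f).sum := by
  have hF' : ∀ τ, ∃ L', τ ∈ L → Sub A τ L' ∧ (∀ κ ∈ L', P κ) ∧ (L'.length : ℝ) ≤ f τ := by
    intro τ
    by_cases hτ : τ ∈ L
    · obtain ⟨L', h⟩ := hF τ hτ; exact ⟨L', fun _ => h⟩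
    · exact ⟨[], fun h => absurd h hτ⟩
  choose F hF'' using hF'
  refine ⟨L.flatMap F, h.flatMap F (fun τ hτ => (hF'' τ hτ).1), ?_,
    length_flatMap_le L F f (fun τ hτ => (hF'' τ hτ).2.2)⟩
  intro κ hκ
  obtain ⟨τ, hτ, hκ'⟩ := List.mem_flatMap.mp hκ
  exact (hF'' τ hτ).2.1 κ hκ'

/-! ### Crossings are superadditive -/

lemma X_lft_sub {σ : Cell ι} (hv : Valid A σ) {p : ι × ι} {x w : ℝ} (hne : p.1 ≠ p.2)
    (hx : x ∈ J A σ p.1)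
    (he : A.G p.1 x = A.G p.2 x) (h2 : w < σ.v) (hm : Meets A (lft σ w) p.1 p.2) : x < w := by
  obtain ⟨-, y, hy, hye⟩ := hm
  rw [J_lft σ _ h2] at hy
  have := A.uniq p.1 p.2 hne x y (hv.J_gt hx) (hv.J_gt hy.1) he hye
  rw [this]; exact hy.2

lemma X_rgt_sub {σ : Cell ι} (hv : Valid A σ) {p : ι × ι} {x w : ℝ} (hne : p.1 ≠ p.2)
    (hx : x ∈ J A σ p.1)
    (he : A.G p.1 x = A.G p.2 x) (h1 : σ.u < w) (hm : Meets A (rgt σ w) p.1 p.2) : w < x := by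
  obtain ⟨-, y, hy, hye⟩ := hm
  rw [J_rgt σ _ h1] at hy
  have := A.uniq p.1 p.2 hne x y (hv.J_gt hx) (hv.J_gt hy.1) he hye
  rw [this]; exact hy.2

lemma X_v {σ : Cell ι} (hv : Valid A σ) {w : ℝ} (h1 : σ.u < w) (h2 : w < σ.v) :
    (Xset A (lft σ w)).card + (Xset A (rgt σ w)).card ≤ (Xset A σ).card := by
  rw [← Finset.card_union_of_disjoint]
  · exact Finset.card_le_card (Finset.union_subset (Xset_mono (lft_sub h2))
      (Xset_mono (rgt_sub h1)))
  · rw [Finset.disjoint_left]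
    intro p hp hp'
    have a := (Finset.mem_filter.mp hp).2
    have b := (Finset.mem_filter.mp hp').2
    obtain ⟨hne, x, hx, he⟩ := a.mono (lft_sub h2)
    exact lt_asymm (X_lft_sub hv hne hx he h2 a) (X_rgt_sub hv hne hx he h1 b)

lemma X_h {σ : Cell ι} (hv : Valid A σ) {c : ι} (hc : Spans A σ c) :
    (Xset A (bot σ c)).card + (Xset A (upp σ c)).card ≤ (Xset A σ).card := by
  rw [← Finset.card_union_of_disjoint]
  · exact Finset.card_le_card (Finset.union_subset (Xset_mono (bot_sub hc))
      (Xset_mono (upp_sub hc)))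
  · rw [Finset.disjoint_left]
    intro p hp hp'
    obtain ⟨hne, x, hx, he⟩ := (Finset.mem_filter.mp hp).2
    obtain ⟨-, y, hy, hye⟩ := (Finset.mem_filter.mp hp').2
    rw [J_bot σ _ hc] at hx
    rw [J_upp σ _ hc] at hy
    have := A.uniq p.1 p.2 hne x y (hv.J_gt hx.1) (hv.J_gt hy.1) he hye
    subst this
    exact lt_asymm (show A.G p.1 x < A.G c x from hx.2) hy.2

lemma Sub.X_sum {σ : Cell ι} {L : List (Cell ι)} (h : Sub A σ L) (hv : Valid A σ) :
    (L.map (fun τ => ((Xset A τ).card : ℝ))).sum ≤ (Xset A σ).card := by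
  induction h with
  | refl σ => simp
  | vs σ w L₁ L₂ h1 h2 _ _ ih1 ih2 =>
    rw [List.map_append, List.sum_append]
    have := X_v hv h1 h2
    have h3 := ih1 (hv.lft h1 h2)
    have h4 := ih2 (hv.rgt h1 h2)
    have : ((Xset A (lft σ w)).card : ℝ) + (Xset A (rgt σ w)).card ≤ (Xset A σ).card := by
      exact_mod_cast this
    linarith
  | hs σ c L₁ L₂ hc _ _ ih1 ih2 =>
    rw [List.map_append, List.sum_append]
    have := X_h hv hc
    have h3 := ih1 (hv.bot hc)
    have h4 := ih2 (hv.upp hc)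
    have : ((Xset A (bot σ c)).card : ℝ) + (Xset A (upp σ c)).card ≤ (Xset A σ).card := by
      exact_mod_cast this
    linarith

/-- Vertical cutting by crossings. -/
lemma vcut (t : ℝ) (ht : 0 < t) : ∀ (N : ℕ) (σ : Cell ι), Valid A σ → (Xset A σ).card = N →
    ∃ L, Sub A σ L ∧ (∀ τ ∈ L, ((Xset A τ).card : ℝ) ≤ t) ∧
      (L.length : ℝ) ≤ 1 + (Xset A σ).card / t := by
  intro N
  induction N using Nat.strong_induction_on with
  | _ N ih =>
  intro σ hv hN
  by_cases hle : ((Xset A σ).card : ℝ) ≤ t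
  · refine ⟨[σ], Sub.refl σ, by simpa using hle, ?_⟩
    have : 0 ≤ ((Xset A σ).card : ℝ) / t := by positivity
    simpa using this
  push Not at hle
  have hf : ∀ p : ι × ι, ∃ x, p ∈ Xset A σ → p.1 ≠ p.2 ∧ x ∈ J A σ p.1 ∧ A.G p.1 x = A.G p.2 x := by
    intro p
    by_cases hp : p ∈ Xset A σ
    · obtain ⟨hne, x, hx, he⟩ := (Finset.mem_filter.mp hp).2
      exact ⟨x, fun _ => ⟨hne, hx, he⟩⟩
    · exact ⟨0, fun h => absurd h hp⟩
  choose f hf using hf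
  have hj : ⌊t⌋₊ < (Xset A σ).card := by
    have := Nat.floor_le ht.le
    exact_mod_cast lt_of_le_of_lt this hle
  obtain ⟨p, hp, hp1, hp2⟩ := quantile (Xset A σ) f _ hj
  have hw := (hf p hp).2.1
  have h1 : σ.u < f p := hw.1
  have h2 : f p < σ.v := hw.2.1
  have hl : (Xset A (lft σ (f p))).card ≤ ⌊t⌋₊ := by
    refine le_trans (Finset.card_le_card ?_) hp1
    intro e he
    have heσ := Xset_mono (lft_sub h2) he
    obtain ⟨a, b, c⟩ := hf e heσ
    exact Finset.mem_filter.mpr ⟨heσ, X_lft_sub hv a b c h2 (Finset.mem_filter.mp he).2⟩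
  have hr : (Xset A (rgt σ (f p))).card + (⌊t⌋₊ + 1) ≤ (Xset A σ).card := by
    refine le_trans (Nat.add_le_add_right (Finset.card_le_card ?_) _) hp2
    intro e he
    have heσ := Xset_mono (rgt_sub h1) he
    obtain ⟨a, b, c⟩ := hf e heσ
    exact Finset.mem_filter.mpr ⟨heσ, X_rgt_sub hv a b c h1 (Finset.mem_filter.mp he).2⟩
  obtain ⟨L, hL, hLX, hLc⟩ := ih _ (by omega) (rgt σ (f p)) (hv.rgt h1 h2) rfl
  refine ⟨[lft σ (f p)] ++ L, Sub.vs σ (f p) _ _ h1 h2 (Sub.refl _) hL, ?_, ?_⟩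
  · intro τ hτ
    rcases List.mem_append.mp hτ with h | h
    · rw [List.mem_singleton.mp h]
      exact le_trans (by exact_mod_cast hl) (Nat.floor_le ht.le)
    · exact hLX τ h
  · have h3 : ((Xset A (rgt σ (f p))).card : ℝ) + t ≤ (Xset A σ).card := by
      have : ((Xset A (rgt σ (f p))).card : ℝ) + (⌊t⌋₊ + 1) ≤ (Xset A σ).card := by
        exact_mod_cast hr
      linarith [Nat.lt_floor_add_one t]
    have h4 : ((Xset A (rgt σ (f p))).card : ℝ) / t + 1 ≤ (Xset A σ).card / t := by
      rw [div_add_one ht.ne']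
      exact div_le_div_of_nonneg_right h3 ht.le
    rw [List.length_append, List.length_singleton]
    push_cast
    linarith

/-! ### Endpoints -/

lemma pos_false {σ : Cell ι} {q : ι} {l r : ℝ} (hlr : l < r) (h : J A σ q = Set.Ioo l r) :
    pos A σ (q, false) = l := by
  simp [pos, h, csInf_Ioo hlr]

lemma pos_true {σ : Cell ι} {q : ι} {l r : ℝ} (hlr : l < r) (h : J A σ q = Set.Ioo l r) :
    pos A σ (q, true) = r := by
  simp [pos, h, csSup_Ioo hlr]

lemma Ioo_bounds {σ : Cell ι} {q : ι} {l r : ℝ} (hlr : l < r) (h : J A σ q = Set.Ioo l r) :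
    σ.u ≤ l ∧ r ≤ σ.v := by
  constructor
  · by_contra hcon
    push Not at hcon
    have : (l + min r σ.u) / 2 ∈ Set.Ioo l r := by
      have h1 : l < min r σ.u := lt_min hlr hcon
      have h2 := min_le_left r σ.u
      constructor <;> linarith
    rw [← h] at this
    have h2 := min_le_right r σ.u
    linarith [this.1]
  · by_contra hcon
    push Not at hcon
    have : (r + max l σ.v) / 2 ∈ Set.Ioo l r := by
      have h1 : max l σ.v < r := max_lt hlr hcon
      have h2 := le_max_left l σ.v
      constructor <;> linarith
    rw [← h] at this
    have h2 := le_max_right l σ.v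
    linarith [this.2.1]

lemma isEnd_false {σ : Cell ι} {q : ι} {l r : ℝ} (hlr : l < r) (h : J A σ q = Set.Ioo l r) :
    IsEnd A σ (q, false) ↔ σ.u < l := by
  unfold IsEnd
  rw [pos_false hlr h]
  have := (Ioo_bounds hlr h).2
  constructor
  · intro h; exact h.2.1
  · intro h'; exact ⟨by simpa [h] using hlr, h', by linarith⟩

lemma isEnd_true {σ : Cell ι} {q : ι} {l r : ℝ} (hlr : l < r) (h : J A σ q = Set.Ioo l r) :
    IsEnd A σ (q, true) ↔ r < σ.v := by
  unfold IsEnd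
  rw [pos_true hlr h]
  have := (Ioo_bounds hlr h).1
  constructor
  · intro h; exact h.2.2
  · intro h'; exact ⟨by simpa [h] using hlr, by linarith, h'⟩

lemma not_isEnd {σ : Cell ι} {e : ι × Bool} (h : J A σ e.1 = ∅) : ¬ IsEnd A σ e := by
  intro h'
  have := h'.1
  rw [h] at this
  exact Set.not_nonempty_empty this

lemma isEnd_lft {σ : Cell ι} (hv : Valid A σ) {w : ℝ} (h2 : w < σ.v)
    {e : ι × Bool} (he : IsEnd A (lft σ w) e) : IsEnd A σ e ∧ pos A σ e < w := by
  obtain ⟨q, b⟩ := e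
  have hne : (J A σ q).Nonempty := he.1.mono (lft_sub h2 q)
  obtain ⟨l, r, hlr, hul, hrv, hJ⟩ := hv.J_Ioo hne
  have hJ' : J A (lft σ w) q = Set.Ioo l (min r w) := by
    rw [J_lft σ q h2, hJ, Set.Ioo_inter_Iio]
  have hlr' : l < min r w := by
    have := he.1
    simp only [hJ', Set.nonempty_Ioo] at this
    exact this
  have hlw := hlr'.trans_le (min_le_right r w)
  cases b with
  | false =>
    have h := (isEnd_false hlr' hJ').mp he
    exact ⟨(isEnd_false hlr hJ).mpr h, by rw [pos_false hlr hJ]; exact hlw⟩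
  | true =>
    have h : min r w < w := (isEnd_true hlr' hJ').mp he
    have hrw : r < w := by
      rcases min_lt_iff.mp h with h | h
      · exact h
      · exact absurd h (lt_irrefl _)
    exact ⟨(isEnd_true hlr hJ).mpr (hrw.trans h2), by rw [pos_true hlr hJ]; exact hrw⟩

lemma isEnd_rgt {σ : Cell ι} (hv : Valid A σ) {w : ℝ} (h1 : σ.u < w)
    {e : ι × Bool} (he : IsEnd A (rgt σ w) e) : IsEnd A σ e ∧ w < pos A σ e := by
  obtain ⟨q, b⟩ := e
  have hne : (J A σ q).Nonempty := he.1.mono (rgt_sub h1 q)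
  obtain ⟨l, r, hlr, hul, hrv, hJ⟩ := hv.J_Ioo hne
  have hJ' : J A (rgt σ w) q = Set.Ioo (max l w) r := by
    rw [J_rgt σ q h1, hJ, Set.Ioo_inter_Ioi]
  have hlr' : max l w < r := by
    have := he.1
    simp only [hJ', Set.nonempty_Ioo] at this
    exact this
  have hlw := (le_max_right l w).trans_lt hlr'
  cases b with
  | true =>
    have h := (isEnd_true hlr' hJ').mp he
    exact ⟨(isEnd_true hlr hJ).mpr h, by rw [pos_true hlr hJ]; exact hlw⟩
  | false =>
    have h : w < max l w := (isEnd_false hlr' hJ').mp he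
    have hrw : w < l := by
      rcases lt_max_iff.mp h with h | h
      · exact h
      · exact absurd h (lt_irrefl _)
    exact ⟨(isEnd_false hlr hJ).mpr (h1.trans hrw), by rw [pos_false hlr hJ]; exact hrw⟩

lemma E_v {σ : Cell ι} (hv : Valid A σ) (hE : 0 < (Eset A σ).card) :
    ∃ w, σ.u < w ∧ w < σ.v ∧ 2 * (Eset A (lft σ w)).card ≤ (Eset A σ).card ∧
      2 * (Eset A (rgt σ w)).card ≤ (Eset A σ).card := by
  obtain ⟨e, he, h1, h2⟩ := quantile (Eset A σ) (pos A σ) (((Eset A σ).card) / 2) (by omega)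
  have hend := (Finset.mem_filter.mp he).2
  refine ⟨pos A σ e, hend.2.1, hend.2.2, ?_, ?_⟩
  · have : (Eset A (lft σ (pos A σ e))).card ≤ (Eset A σ).card / 2 := by
      refine le_trans (Finset.card_le_card ?_) h1
      intro f hf
      have hf' := Finset.mem_filter.mp hf
      obtain ⟨a, b⟩ := isEnd_lft hv hend.2.2 hf'.2
      exact Finset.mem_filter.mpr ⟨Finset.mem_filter.mpr ⟨hf'.1, a⟩, b⟩
    omega
  · have : (Eset A (rgt σ (pos A σ e))).card + ((Eset A σ).card / 2 + 1) ≤ (Eset A σ).card := by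
      refine le_trans (Nat.add_le_add_right (Finset.card_le_card ?_) _) h2
      intro f hf
      have hf' := Finset.mem_filter.mp hf
      obtain ⟨a, b⟩ := isEnd_rgt hv hend.2.1 hf'.2
      exact Finset.mem_filter.mpr ⟨Finset.mem_filter.mpr ⟨hf'.1, a⟩, b⟩
    omega

lemma Eset_card (σ : Cell ι) : (Eset A σ).card =
    ∑ q ∈ A.Q, ((if IsEnd A σ (q, true) then 1 else 0) +
      (if IsEnd A σ (q, false) then 1 else 0)) := by
  rw [Eset, Finset.card_filter, Finset.sum_product]
  refine Finset.sum_congr rfl (fun q _ => ?_)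
  rw [Fintype.sum_bool]

lemma isEnd_congr {σ τ : Cell ι} {e : ι × Bool} (h : J A τ e.1 = J A σ e.1) (hu : τ.u = σ.u)
    (hv : τ.v = σ.v) : IsEnd A τ e ↔ IsEnd A σ e := by
  unfold IsEnd pos
  rw [h, hu, hv]

/-- a curve not meeting `c` is on one side. -/
lemma one_side {σ : Cell ι} (hv : Valid A σ) {c q : ι}
    (hno : ∀ x ∈ J A σ q, A.G q x ≠ A.G c x) :
    (∀ x ∈ J A σ q, A.G q x < A.G c x) ∨ (∀ x ∈ J A σ q, A.G c x < A.G q x) := by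
  by_contra hcon
  push Not at hcon
  obtain ⟨⟨x, hx, hx'⟩, y, hy, hy'⟩ := hcon
  have := (hv.J_ord q).isPreconnected.intermediate_value₂ hy hx (A.cont q).continuousOn
    (A.cont c).continuousOn hy' hx'
  obtain ⟨z, hz, hze⟩ := this
  exact hno z hz hze

lemma E_h {σ : Cell ι} (hv : Valid A σ) {c : ι} (hc : Spans A σ c) :
    (Eset A (bot σ c)).card + (Eset A (upp σ c)).card ≤
      (Eset A σ).card + 2 * (crossing A σ c).card := by
  rw [Eset_card, Eset_card, Eset_card, crossing, Finset.card_filter, Finset.mul_sum,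
    ← Finset.sum_add_distrib, ← Finset.sum_add_distrib]
  refine Finset.sum_le_sum (fun q hq => ?_)
  have hb := J_bot σ q hc
  have hu := J_upp σ q hc
  by_cases hex : ∃ x ∈ J A σ q, A.G q x = A.G c x
  swap
  · push Not at hex
    rcases one_side hv hex with h | h
    · have e1 : J A (bot σ c) q = J A σ q := by
        rw [hb]; exact Set.inter_eq_left.mpr h
      have e2 : J A (upp σ c) q = ∅ := by
        rw [hu]; ext x
        constructor
        · rintro ⟨a, b⟩; exact lt_asymm (h x a) b
        · intro h; exact h.elim
      simp only [isEnd_congr (τ := bot σ c) (σ := σ) (e := (q, true)) e1 rfl rfl,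
        isEnd_congr (τ := bot σ c) (σ := σ) (e := (q, false)) e1 rfl rfl,
        not_isEnd (σ := upp σ c) (e := (q, true)) e2,
        not_isEnd (σ := upp σ c) (e := (q, false)) e2]
      simp
    · have e1 : J A (upp σ c) q = J A σ q := by
        rw [hu]; exact Set.inter_eq_left.mpr h
      have e2 : J A (bot σ c) q = ∅ := by
        rw [hb]; ext x
        constructor
        · rintro ⟨a, b⟩; exact lt_asymm (h x a) b
        · intro h; exact h.elim
      simp only [isEnd_congr (τ := upp σ c) (σ := σ) (e := (q, true)) e1 rfl rfl,
        isEnd_congr (τ := upp σ c) (σ := σ) (e := (q, false)) e1 rfl rfl,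
        not_isEnd (σ := bot σ c) (e := (q, true)) e2,
        not_isEnd (σ := bot σ c) (e := (q, false)) e2]
      simp
  by_cases hqc : c = q
  · subst hqc
    have e1 : J A (bot σ c) c = ∅ := by
      rw [hb]; ext x; simp
    have e2 : J A (upp σ c) c = ∅ := by
      rw [hu]; ext x; simp
    simp only [not_isEnd (σ := bot σ c) (e := (c, true)) e1,
        not_isEnd (σ := bot σ c) (e := (c, false)) e1,
        not_isEnd (σ := upp σ c) (e := (c, true)) e2,
        not_isEnd (σ := upp σ c) (e := (c, false)) e2]
    simp
  obtain ⟨x, hx, hxe⟩ := hex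
  have hmeet : Meets A σ c q := ⟨hqc, x, hc x hx.1 hx.2.1, hxe.symm⟩
  have huniq : ∀ y ∈ J A σ q, y ≠ x → A.G q y ≠ A.G c y := by
    intro y hy hyx he
    exact hyx (A.uniq q c (Ne.symm hqc) y x (hv.J_gt hy) (hv.J_gt hx) he hxe)
  obtain ⟨l, r, hlr, hul, hrv, hJ⟩ := hv.J_Ioo ⟨x, hx⟩
  have hx' : x ∈ Set.Ioo l r := by rw [← hJ]; exact hx
  have hob := (hv.bot hc).J_ord q
  have hou := (hv.upp hc).J_ord q
  have hxb : x ∉ J A (bot σ c) q := by rw [hb]; rintro ⟨-, h⟩; exact absurd hxe (ne_of_lt h)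
  have hxu : x ∉ J A (upp σ c) q := by rw [hu]; rintro ⟨-, h⟩; exact absurd hxe.symm (ne_of_lt h)
  have hcov : ∀ y ∈ Set.Ioo l r, y ≠ x → y ∈ J A (bot σ c) q ∨ y ∈ J A (upp σ c) q := by
    intro y hy hyx
    rw [← hJ] at hy
    rcases lt_or_gt_of_ne (huniq y hy hyx) with h | h
    · left; rw [hb]; exact ⟨hy, h⟩
    · right; rw [hu]; exact ⟨hy, h⟩
  have hdis : ∀ y, y ∈ J A (bot σ c) q → y ∈ J A (upp σ c) q → False := by
    intro y h1 h2
    rw [hb] at h1; rw [hu] at h2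
    exact lt_asymm (show A.G q y < A.G c y from h1.2) h2.2
  -- main split: two ord-connected sets S, S' partitioning Ioo l r minus x
  have key : ∀ S S' : Set ℝ, S.OrdConnected → S'.OrdConnected → S ⊆ Set.Ioo l r →
      S' ⊆ Set.Ioo l r → x ∉ S → x ∉ S' → (∀ y ∈ Set.Ioo l r, y ≠ x → y ∈ S ∨ y ∈ S') →
      (∀ y, y ∈ S → y ∈ S' → False) → (l + x) / 2 ∈ S →
      S = Set.Ioo l x ∧ S' = Set.Ioo x r := by
    intro S S' hS hS' hSs hSs' hxS hxS' hcov hdis hmem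
    have hSl : ∀ y ∈ S, y < x := by
      intro y hy
      by_contra hcon
      push Not at hcon
      exact hxS (hS.out hmem hy ⟨by linarith [hx'.1], hcon⟩)
    have hrS : (x + r) / 2 ∈ S' := by
      rcases hcov ((x + r) / 2) ⟨by linarith [hx'.1, hx'.2], by linarith [hx'.2]⟩
        (by linarith [hx'.2] : x < (x + r) / 2).ne' with h | h
      · linarith [hSl _ h, hx'.2]
      · exact h
    have hSr : ∀ y ∈ S', x < y := by
      intro y hy
      by_contra hcon
      push Not at hcon
      exact hxS' (hS'.out hy hrS ⟨hcon, by linarith [hx'.2]⟩)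
    constructor
    · ext y
      constructor
      · intro hy; exact ⟨(hSs hy).1, hSl y hy⟩
      · rintro ⟨h1, h2⟩
        rcases hcov y ⟨h1, h2.trans hx'.2⟩ h2.ne with h | h
        · exact h
        · exact absurd (hSr y h) (not_lt.mpr h2.le)
    · ext y
      constructor
      · intro hy; exact ⟨hSr y hy, (hSs' hy).2⟩
      · rintro ⟨h1, h2⟩
        rcases hcov y ⟨hx'.1.trans h1, h2⟩ h1.ne' with h | h
        · exact absurd (hSl y h) (not_lt.mpr h1.le)
        · exact h
  have hsb : J A (bot σ c) q ⊆ Set.Ioo l r := by rw [← hJ]; exact bot_sub hc q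
  have hsu : J A (upp σ c) q ⊆ Set.Ioo l r := by rw [← hJ]; exact upp_sub hc q
  have hxv : x < σ.v := hx.2.1
  have hux : σ.u < x := hx.1
  have eT := isEnd_true hlr hJ
  have eF := isEnd_false hlr hJ
  simp only [hmeet, if_true]
  rcases hcov ((l + x) / 2) ⟨by linarith [hx'.1], by linarith [hx'.1, hx'.2]⟩
    (by linarith [hx'.1] : (l + x) / 2 < x).ne with h | h
  · obtain ⟨a, b⟩ := key _ _ hob hou hsb hsu hxb hxu hcov hdis h
    have h1 := isEnd_false hx'.1 a
    have h2 := isEnd_true hx'.2 b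
    have h1' : IsEnd A (bot σ c) (q, false) ↔ IsEnd A σ (q, false) := h1.trans eF.symm
    have h2' : IsEnd A (upp σ c) (q, true) ↔ IsEnd A σ (q, true) := h2.trans eT.symm
    simp only [h1', h2']
    split_ifs <;> omega
  · obtain ⟨a, b⟩ := key _ _ hou hob hsu hsb hxu hxb (fun y hy hyx => (hcov y hy hyx).symm)
      (fun y h1 h2 => hdis y h2 h1) h
    have h1 := isEnd_false hx'.1 a
    have h2 := isEnd_true hx'.2 b
    have h1' : IsEnd A (upp σ c) (q, false) ↔ IsEnd A σ (q, false) := h1.trans eF.symm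
    have h2' : IsEnd A (bot σ c) (q, true) ↔ IsEnd A σ (q, true) := h2.trans eT.symm
    simp only [h1', h2']
    split_ifs <;> omega

lemma E_le (σ : Cell ι) : (Eset A σ).card ≤ 2 * (M A σ).card := by
  have : Eset A σ ⊆ M A σ ×ˢ Finset.univ := by
    intro e he
    have := Finset.mem_filter.mp he
    have h2 := Finset.mem_product.mp this.1
    exact Finset.mem_product.mpr ⟨Finset.mem_filter.mpr ⟨h2.1, this.2.1⟩, h2.2⟩
  have := Finset.card_le_card this
  rw [Finset.card_product] at this
  simpa [mul_comm] using this

lemma M_le {σ : Cell ι} (hv : Valid A σ) :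
    (M A σ).card ≤ (A.Q.filter (Spans A σ)).card + (Eset A σ).card := by
  have : M A σ ⊆ A.Q.filter (Spans A σ) ∪ (Eset A σ).image Prod.fst := by
    intro q hq
    obtain ⟨hqQ, hne⟩ := Finset.mem_filter.mp hq
    obtain ⟨l, r, hlr, hul, hrv, hJ⟩ := hv.J_Ioo hne
    rw [Finset.mem_union]
    by_cases h1 : σ.u < l
    · right
      exact Finset.mem_image.mpr ⟨(q, false), Finset.mem_filter.mpr
        ⟨by simp [hqQ], (isEnd_false hlr hJ).mpr h1⟩, rfl⟩
    by_cases h2 : r < σ.v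
    · right
      exact Finset.mem_image.mpr ⟨(q, true), Finset.mem_filter.mpr
        ⟨by simp [hqQ], (isEnd_true hlr hJ).mpr h2⟩, rfl⟩
    left
    refine Finset.mem_filter.mpr ⟨hqQ, fun x hx hx' => ?_⟩
    rw [hJ]
    push Not at h1 h2
    exact ⟨by linarith, by linarith⟩
  refine (Finset.card_le_card this).trans ((Finset.card_union_le _ _).trans ?_)
  exact Nat.add_le_add_left Finset.card_image_le _

/-- Horizontal cutting. -/
lemma hcut (B : ℕ) (hB : 1 ≤ B) (κ : ℝ) (Gd : Finset ι) : ∀ (N : ℕ) (σ : Cell ι),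
    Valid A σ → (∀ q ∈ Gd, ((crossing A σ q).card : ℝ) ≤ κ) → (Gd.filter (Spans A σ)).card = N →
    ∃ L, Sub A σ L ∧ (∀ τ ∈ L, (Gd.filter (Spans A τ)).card < B) ∧
      ∃ p : ℕ, L.length = p + 1 ∧ p * B ≤ (Gd.filter (Spans A σ)).card ∧
      (L.map (fun τ => ((Eset A τ).card : ℝ))).sum ≤ (Eset A σ).card + 2 * κ * p := by
  intro N
  induction N using Nat.strong_induction_on with
  | _ N ih =>
  intro σ hv hcr hN
  by_cases hlt : (Gd.filter (Spans A σ)).card < B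
  · exact ⟨[σ], Sub.refl σ, by simpa using hlt, 0, by simp, by simp, by simp⟩
  push Not at hlt
  set x₁ : ℝ := (σ.u + σ.v) / 2 with hx₁
  have huv := hv.uv
  have hx1 : σ.u < x₁ := by rw [hx₁]; linarith
  have hx2 : x₁ < σ.v := by rw [hx₁]; linarith
  obtain ⟨c, hcm, h1, h2⟩ := quantile (Gd.filter (Spans A σ)) (fun q => A.G q x₁) (B - 1) (by omega)
  obtain ⟨hcG, hc⟩ := Finset.mem_filter.mp hcm
  have hbot : (Gd.filter (Spans A (bot σ c))).card < B := by
    refine lt_of_le_of_lt (le_trans (Finset.card_le_card ?_) h1) (by omega)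
    intro q hq
    obtain ⟨hqG, hqs⟩ := Finset.mem_filter.mp hq
    refine Finset.mem_filter.mpr ⟨Finset.mem_filter.mpr ⟨hqG, fun x a b =>
      bot_sub hc q (hqs x a b)⟩, ?_⟩
    exact (hqs x₁ hx1 hx2).2.2.2
  have hupp : (Gd.filter (Spans A (upp σ c))).card + B ≤ (Gd.filter (Spans A σ)).card := by
    have : (Gd.filter (Spans A (upp σ c))).card + (B - 1 + 1) ≤ (Gd.filter (Spans A σ)).card := by
      refine le_trans (Nat.add_le_add_right (Finset.card_le_card ?_) _) h2
      intro q hq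
      obtain ⟨hqG, hqs⟩ := Finset.mem_filter.mp hq
      refine Finset.mem_filter.mpr ⟨Finset.mem_filter.mpr ⟨hqG, fun x a b =>
        upp_sub hc q (hqs x a b)⟩, ?_⟩
      exact (hqs x₁ hx1 hx2).2.2.1
    omega
  obtain ⟨L, hL, hLs, p, hp, hpB, hE⟩ := ih _ (by omega) (upp σ c) (hv.upp hc)
    (fun q hq => le_trans (by exact_mod_cast Finset.card_le_card (crossing_mono (upp_sub hc) q))
      (hcr q hq)) rfl
  refine ⟨[bot σ c] ++ L, Sub.hs σ c _ _ hc (Sub.refl _) hL, ?_, p + 1, ?_, ?_, ?_⟩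
  · intro τ hτ
    rcases List.mem_append.mp hτ with h | h
    · rw [List.mem_singleton.mp h]; exact hbot
    · exact hLs τ h
  · simp [hp]
  · rw [Nat.add_mul]; omega
  · have h3 := E_h hv hc
    have h3' : ((Eset A (bot σ c)).card : ℝ) + (Eset A (upp σ c)).card ≤
      (Eset A σ).card + 2 * (crossing A σ c).card := by exact_mod_cast h3
    have h4 := hcr c hcG
    simp only [List.map_append, List.map_cons, List.map_nil, List.sum_append, List.sum_cons,
      List.sum_nil]
    push_cast
    linarith

lemma list_sum_le {α : Type} (L : List α) (f g : α → ℝ) (h : ∀ a ∈ L, f a ≤ g a) :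
    (L.map f).sum ≤ (L.map g).sum := List.sum_le_sum h

lemma le_list_sum {α : Type} (L : List α) (f : α → ℝ) (h : ∀ a ∈ L, 0 ≤ f a) {a : α}
    (ha : a ∈ L) : f a ≤ (L.map f).sum := by
  refine List.single_le_sum ?_ _ (List.mem_map_of_mem ha)
  intro x hx
  obtain ⟨b, hb, rfl⟩ := List.mem_map.mp hx
  exact h b hb

lemma list_sum_affine {α : Type} (L : List α) (f : α → ℝ) (s t : ℝ) :
    (L.map (fun a => s + t * f a)).sum = s * L.length + t * (L.map f).sum := by
  induction L with
  | nil => simp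
  | cons a L ih => simp only [List.map_cons, List.sum_cons, ih, List.length_cons]; push_cast; ring

/-- Few curves cross many others. -/
lemma bad_card (σ : Cell ι) (κ : ℝ) :
    ((A.Q.filter (fun q => κ < ((crossing A σ q).card : ℝ))).card : ℝ) * κ ≤ (Xset A σ).card := by
  have h := sum_crossing (A := A) σ
  have h1 : (∑ c ∈ A.Q, ((crossing A σ c).card : ℝ)) = (Xset A σ).card := by exact_mod_cast h
  rw [← h1, ← nsmul_eq_mul]
  refine le_trans (Finset.card_nsmul_le_sum _ (fun c => ((crossing A σ c).card : ℝ)) κ ?_) ?_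
  · intro q hq; exact (Finset.mem_filter.mp hq).2.le
  · exact Finset.sum_le_sum_of_subset_of_nonneg (Finset.filter_subset _ _)
      (fun _ _ _ => Nat.cast_nonneg _)


lemma hstep (K ρ θ : ℝ) (hK : 0 < K) (hθ : 0 < θ) (hθρ : 512 * θ * ρ ≤ 1)
    (σ : Cell ι) (hv : Valid A σ)
    (hM : ((M A σ).card : ℝ) ≤ ρ * K) (hX : ((Xset A σ).card : ℝ) ≤ θ / 16 * K ^ 2) :
    ∃ L, Sub A σ L ∧ (∀ τ ∈ L, ((M A τ).card : ℝ) ≤ K / 8 + (Eset A τ).card ∧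
        ((Eset A τ).card : ℝ) ≤ (Eset A σ).card + K / 16) ∧
      ∃ p : ℕ, L.length = p + 1 ∧ (p : ℝ) ≤ 16 * ((M A σ).card / K) ∧
      (L.map (fun τ => ((Eset A τ).card : ℝ))).sum ≤ (Eset A σ).card + 2 * (θ * K) * p := by
  set Bad := A.Q.filter (fun q => θ * K < ((crossing A σ q).card : ℝ)) with hBad
  set Gd := A.Q.filter (fun q => ((crossing A σ q).card : ℝ) ≤ θ * K) with hGd
  have hbad : (Bad.card : ℝ) ≤ K / 16 := by
    have h := bad_card (A := A) σ (θ * K)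
    rw [← hBad] at h
    have h2 : (Bad.card : ℝ) * (θ * K) ≤ K / 16 * (θ * K) := by
      calc _ ≤ _ := h
        _ ≤ _ := hX
        _ = _ := by ring
    exact le_of_mul_le_mul_right h2 (by positivity)
  have hB1 : 1 ≤ ⌈K / 16⌉₊ := Nat.one_le_ceil_iff.mpr (by positivity)
  obtain ⟨L, hL, hLs, p, hp, hpB, hE⟩ := hcut (A := A) ⌈K / 16⌉₊ hB1 (θ * K) Gd _ σ hv
    (fun q hq => (Finset.mem_filter.mp hq).2) rfl
  have hspan : ((Gd.filter (Spans A σ)).card : ℝ) ≤ (M A σ).card := by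
    have : Gd.filter (Spans A σ) ⊆ M A σ := by
      intro q hq
      obtain ⟨a, b⟩ := Finset.mem_filter.mp hq
      have huv := hv.uv
      exact Finset.mem_filter.mpr ⟨(Finset.mem_filter.mp a).1, (σ.u + σ.v) / 2,
        b _ (by linarith) (by linarith)⟩
    exact_mod_cast Finset.card_le_card this
  have hpK : (p : ℝ) * (K / 16) ≤ (M A σ).card := by
    have h1 : (p : ℝ) * (K / 16) ≤ p * (⌈K / 16⌉₊ : ℝ) :=
      mul_le_mul_of_nonneg_left (Nat.le_ceil _) (Nat.cast_nonneg _)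
    have h2 : (p : ℝ) * (⌈K / 16⌉₊ : ℝ) ≤ (Gd.filter (Spans A σ)).card := by exact_mod_cast hpB
    linarith
  have hp16 : (p : ℝ) ≤ 16 * ((M A σ).card / K) := by
    rw [← mul_div_assoc, le_div_iff₀ hK]
    linarith
  have hpρ : (p : ℝ) ≤ 16 * ρ := by
    refine hp16.trans ?_
    have : ((M A σ).card : ℝ) / K ≤ ρ := by rwa [div_le_iff₀ hK]
    linarith
  refine ⟨L, hL, fun τ hτ => ⟨?_, ?_⟩, p, hp, hp16, hE⟩
  · have h1 := M_le (hL.valid hv τ hτ)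
    have h2 : (A.Q.filter (Spans A τ)).card ≤ (Gd.filter (Spans A τ)).card + Bad.card := by
      refine le_trans (Finset.card_le_card ?_) (Finset.card_union_le _ _)
      intro q hq
      obtain ⟨a, b⟩ := Finset.mem_filter.mp hq
      rw [Finset.mem_union]
      rcases le_or_gt ((crossing A σ q).card : ℝ) (θ * K) with h | h
      · left; exact Finset.mem_filter.mpr ⟨Finset.mem_filter.mpr ⟨a, h⟩, b⟩
      · right; exact Finset.mem_filter.mpr ⟨a, h⟩
    have h3 : ((Gd.filter (Spans A τ)).card : ℝ) + 1 ≤ ⌈K / 16⌉₊ := by exact_mod_cast hLs τ hτ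
    have h4 := Nat.ceil_lt_add_one (show 0 ≤ K / 16 by positivity)
    have h5 : ((M A τ).card : ℝ) ≤ (Gd.filter (Spans A τ)).card + Bad.card + (Eset A τ).card := by
      have := h1.trans (Nat.add_le_add_right h2 _)
      exact_mod_cast this
    linarith
  · have h1 := le_list_sum L (fun τ => ((Eset A τ).card : ℝ)) (fun _ _ => Nat.cast_nonneg _) hτ
    have h2 : 2 * (θ * K) * p ≤ 2 * (θ * K) * (16 * ρ) :=
      mul_le_mul_of_nonneg_left hpρ (by positivity)
    have h3 : 2 * (θ * K) * (16 * ρ) = (512 * θ * ρ) * K / 16 := by ring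
    have h4 : (512 * θ * ρ) * K ≤ 1 * K := mul_le_mul_of_nonneg_right hθρ hK.le
    linarith

/-- Main recursion. -/
lemma main_rec (K ρ θ : ℝ) (hK : 0 < K) (hθ : 0 < θ) (hθρ : 512 * θ * ρ ≤ 1)
    (D : ℕ) (hθD : 176 * θ * D ≤ 1) : ∀ (d : ℕ), d ≤ D → ∀ σ : Cell ι, Valid A σ →
    ((M A σ).card : ℝ) ≤ ρ * K → ((Xset A σ).card : ℝ) ≤ θ / 16 * K ^ 2 →
    ((Eset A σ).card : ℝ) ≤ 2 ^ d * K / 8 + K / 8 →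
    ∃ L, Sub A σ L ∧ (∀ τ ∈ L, ((M A τ).card : ℝ) ≤ K) ∧
      (L.length : ℝ) ≤ 1 + 32 * ((M A σ).card / K) + 88 * d * ((Eset A σ).card / K) := by
  intro d
  induction d with
  | zero =>
    intro _ σ hv hM hX hE
    obtain ⟨L, hL, hτ, p, hp, hp16, hsum⟩ := hstep K ρ θ hK hθ hθρ σ hv hM hX
    refine ⟨L, hL, fun τ h => ?_, ?_⟩
    · obtain ⟨h1, h2⟩ := hτ τ h
      simp only [pow_zero] at hE
      linarith
    · rw [hp]
      have : 0 ≤ ((M A σ).card : ℝ) / K := by positivity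
      push_cast
      linarith
  | succ d ih =>
    intro hd σ hv hM hX hE
    obtain ⟨L, hL, hτ, p, hp, hp16, hsum⟩ := hstep K ρ θ hK hθ hθρ σ hv hM hX
    set t : ℝ := 88 * ((d : ℝ) + 1) / K with ht
    have ht0 : 0 ≤ t := by positivity
    obtain ⟨L', hL', hP, hlen⟩ := hL.bind (fun τ => ((M A τ).card : ℝ) ≤ K)
      (fun τ => 1 + t * ((Eset A τ).card : ℝ)) (by
        intro τ hτL
        obtain ⟨h1, h2⟩ := hτ τ hτL
        have hvτ := hL.valid hv τ hτL
        have hsub := hL.sub τ hτL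
        by_cases hact : ((Eset A τ).card : ℝ) ≤ K / 2
        · refine ⟨[τ], Sub.refl τ, ?_, ?_⟩
          · intro κ hκ
            rw [List.mem_singleton.mp hκ]
            linarith
          · have : 0 ≤ t * ((Eset A τ).card : ℝ) := by positivity
            simpa using this
        push Not at hact
        have hpos : 0 < (Eset A τ).card := by
          have : (0 : ℝ) < (Eset A τ).card := by linarith
          exact_mod_cast this
        obtain ⟨w, hw1, hw2, hE1, hE2⟩ := E_v hvτ hpos
        have hE1' : 2 * ((Eset A (lft τ w)).card : ℝ) ≤ (Eset A τ).card := by exact_mod_cast hE1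
        have hE2' : 2 * ((Eset A (rgt τ w)).card : ℝ) ≤ (Eset A τ).card := by exact_mod_cast hE2
        have hM1 : ((M A (lft τ w)).card : ℝ) ≤ (M A τ).card := by
          exact_mod_cast Finset.card_le_card (M_mono (lft_sub hw2))
        have hM2 : ((M A (rgt τ w)).card : ℝ) ≤ (M A τ).card := by
          exact_mod_cast Finset.card_le_card (M_mono (rgt_sub hw1))
        have hMτ : ((M A τ).card : ℝ) ≤ (M A σ).card := by
          exact_mod_cast Finset.card_le_card (M_mono hsub)
        have hXτ : ((Xset A τ).card : ℝ) ≤ (Xset A σ).card := by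
          exact_mod_cast Finset.card_le_card (Xset_mono hsub)
        have hX1 : ((Xset A (lft τ w)).card : ℝ) ≤ (Xset A τ).card := by
          exact_mod_cast Finset.card_le_card (Xset_mono (lft_sub hw2))
        have hX2 : ((Xset A (rgt τ w)).card : ℝ) ≤ (Xset A τ).card := by
          exact_mod_cast Finset.card_le_card (Xset_mono (rgt_sub hw1))
        rw [pow_succ] at hE
        obtain ⟨L1, hL1, hP1, hl1⟩ := ih (by omega) (lft τ w) (hvτ.lft hw1 hw2) (by linarith)
          (by linarith) (by linarith)
        obtain ⟨L2, hL2, hP2, hl2⟩ := ih (by omega) (rgt τ w) (hvτ.rgt hw1 hw2) (by linarith)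
          (by linarith) (by linarith)
        refine ⟨L1 ++ L2, Sub.vs τ w _ _ hw1 hw2 hL1 hL2, ?_, ?_⟩
        · intro κ hκ
          rcases List.mem_append.mp hκ with h | h
          · exact hP1 κ h
          · exact hP2 κ h
        · rw [List.length_append]
          push_cast
          have a1 : ((M A (lft τ w)).card : ℝ) / K ≤ 5 / 4 * ((Eset A τ).card / K) := by
            rw [← mul_div_assoc]; exact div_le_div_of_nonneg_right (by linarith) hK.le
          have a2 : ((M A (rgt τ w)).card : ℝ) / K ≤ 5 / 4 * ((Eset A τ).card / K) := by
            rw [← mul_div_assoc]; exact div_le_div_of_nonneg_right (by linarith) hK.le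
          have a3 : 1 / 2 ≤ ((Eset A τ).card : ℝ) / K := by
            rw [le_div_iff₀ hK]; linarith
          have a4 : 88 * (d : ℝ) * ((Eset A (lft τ w)).card / K) +
              88 * (d : ℝ) * ((Eset A (rgt τ w)).card / K) ≤
              88 * (d : ℝ) * ((Eset A τ).card / K) := by
            rw [← mul_add, ← add_div]
            exact mul_le_mul_of_nonneg_left
              (div_le_div_of_nonneg_right (by linarith) hK.le) (by positivity)
          have a5 : t * ((Eset A τ).card : ℝ) =
              88 * (d : ℝ) * ((Eset A τ).card / K) + 88 * ((Eset A τ).card / K) := by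
            rw [ht]; ring
          rw [a5]
          linarith)
    refine ⟨L', hL', hP, hlen.trans ?_⟩
    rw [list_sum_affine L (fun τ => ((Eset A τ).card : ℝ)) 1 t, hp]
    have b1 : t * (L.map (fun τ => ((Eset A τ).card : ℝ))).sum ≤
        t * ((Eset A σ).card + 2 * (θ * K) * p) := mul_le_mul_of_nonneg_left hsum ht0
    have b2 : t * ((Eset A σ).card + 2 * (θ * K) * p) =
        88 * ((d : ℝ) + 1) * ((Eset A σ).card / K) + 176 * θ * ((d : ℝ) + 1) * p := by
      rw [ht]; field_simp; ring
    have b3 : 176 * θ * ((d : ℝ) + 1) ≤ 1 := by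
      have : ((d : ℝ) + 1) ≤ D := by exact_mod_cast hd
      refine le_trans (mul_le_mul_of_nonneg_left this (by positivity)) hθD
    have b4 : 176 * θ * ((d : ℝ) + 1) * p ≤ 1 * p :=
      mul_le_mul_of_nonneg_right b3 (Nat.cast_nonneg _)
    push_cast
    linarith

/-- One step of the hierarchy. -/
lemma one_step (K ρ θ : ℝ) (hK : 0 < K) (hρ : 0 ≤ ρ) (hθ : 0 < θ) (hθρ : 512 * θ * ρ ≤ 1)
    (D : ℕ) (hθD : 176 * θ * D ≤ 1) (hD : 16 * ρ ≤ 2 ^ D) (σ : Cell ι) (hv : Valid A σ)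
    (hM : ((M A σ).card : ℝ) ≤ ρ * K) :
    ∃ L, Sub A σ L ∧ (∀ τ ∈ L, ((M A τ).card : ℝ) ≤ K) ∧
      (L.length : ℝ) ≤ (1 + 32 * ρ + 176 * D * ρ) *
        (1 + (Xset A σ).card / (θ / 16 * K ^ 2)) := by
  obtain ⟨L, hL, hX, hlen⟩ := vcut (A := A) (θ / 16 * K ^ 2) (by positivity) _ σ hv rfl
  obtain ⟨L', hL', hP, hlen'⟩ := hL.bind (fun τ => ((M A τ).card : ℝ) ≤ K)
    (fun τ => (1 + 32 * ρ + 176 * D * ρ) + 0 * 0) (by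
      intro τ hτ
      have hMτ : ((M A τ).card : ℝ) ≤ (M A σ).card := by
        exact_mod_cast Finset.card_le_card (M_mono (hL.sub τ hτ))
      have hE : ((Eset A τ).card : ℝ) ≤ 2 * (M A τ).card := by exact_mod_cast E_le τ
      have hE' : ((Eset A τ).card : ℝ) ≤ 2 * ρ * K := by linarith
      have hDK : 16 * ρ * K ≤ 2 ^ D * K := mul_le_mul_of_nonneg_right hD hK.le
      obtain ⟨L1, hL1, hP1, hl1⟩ := main_rec K ρ θ hK hθ hθρ D hθD D le_rfl τ
        (hL.valid hv τ hτ) (by linarith) (hX τ hτ) (by linarith)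
      refine ⟨L1, hL1, hP1, hl1.trans ?_⟩
      have c1 : ((M A τ).card : ℝ) / K ≤ ρ := by rw [div_le_iff₀ hK]; linarith
      have c2 : ((Eset A τ).card : ℝ) / K ≤ 2 * ρ := by rwa [div_le_iff₀ hK]
      have c3 : 88 * (D : ℝ) * ((Eset A τ).card / K) ≤ 88 * D * (2 * ρ) :=
        mul_le_mul_of_nonneg_left c2 (by positivity)
      linarith)
  refine ⟨L', hL', hP, hlen'.trans ?_⟩
  rw [list_sum_affine L (fun _ => (0 : ℝ))]
  have : 0 ≤ 1 + 32 * ρ + 176 * D * ρ := by positivity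
  have := mul_le_mul_of_nonneg_left hlen this
  linarith

/-! ### Geometry of upper unit semicircles -/

lemma slope_lt {a b : ℝ} (hab : a < b) (ha : 0 < 1 - a ^ 2) (hb : 0 < 1 - b ^ 2) :
    a / √(1 - a ^ 2) < b / √(1 - b ^ 2) := by
  have hsa := Real.sqrt_pos.mpr ha
  have hsb := Real.sqrt_pos.mpr hb
  rw [div_lt_div_iff₀ hsa hsb]
  rcases le_or_gt 0 a with h | h
  · have : √(1 - b ^ 2) ≤ √(1 - a ^ 2) := Real.sqrt_le_sqrt (by nlinarith)
    nlinarith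
  · rcases le_or_gt b 0 with h' | h'
    · have : √(1 - a ^ 2) ≤ √(1 - b ^ 2) := Real.sqrt_le_sqrt (by nlinarith)
      nlinarith
    · nlinarith

lemma conv_dom {p x y z : ℝ} {c : ℝ} (hx : 0 < c - (x - p) ^ 2) (hy : 0 < c - (y - p) ^ 2)
    (h1 : x ≤ z) (h2 : z ≤ y) : 0 < c - (z - p) ^ 2 := by
  rcases le_or_gt 0 (z - p) with h | h
  · nlinarith
  · nlinarith

lemma diff_strictMono {p p' x y : ℝ} (hp : p' < p) (hxy : x < y)
    (hx : 0 < 1 - (x - p) ^ 2) (hy : 0 < 1 - (y - p) ^ 2)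
    (hx' : 0 < 1 - (x - p') ^ 2) (hy' : 0 < 1 - (y - p') ^ 2) :
    √(1 - (x - p) ^ 2) - √(1 - (x - p') ^ 2) < √(1 - (y - p) ^ 2) - √(1 - (y - p') ^ 2) := by
  have hd : ∀ c : ℝ, ∀ z, 0 < 1 - (z - c) ^ 2 →
      HasDerivAt (fun t => √(1 - (t - c) ^ 2)) (-((z - c) / √(1 - (z - c) ^ 2))) z := by
    intro c z hz
    have h1 : HasDerivAt (fun t : ℝ => 1 - (t - c) ^ 2) (-(2 * (z - c))) z := by
      have h0 : HasDerivAt (fun t : ℝ => t - c) 1 z := (hasDerivAt_id z).sub_const c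
      have := (h0.pow 2).const_sub 1
      simpa using this
    have h2 := h1.sqrt hz.ne'
    convert h2 using 1
    have := (Real.sqrt_pos.mpr hz).ne'
    field_simp
  have hm : StrictMonoOn (fun t => √(1 - (t - p) ^ 2) - √(1 - (t - p') ^ 2)) (Set.Icc x y) := by
    refine strictMonoOn_of_deriv_pos (convex_Icc x y) ?_ ?_
    · exact Continuous.continuousOn (by fun_prop)
    · intro z hz
      rw [interior_Icc] at hz
      have h1 := conv_dom hx hy hz.1.le hz.2.le
      have h2 := conv_dom hx' hy' hz.1.le hz.2.le
      have h3 := ((hd p z h1).sub (hd p' z h2)).deriv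
      have h4 := slope_lt (show z - p < z - p' by linarith) h1 h2
      have h5 : deriv (fun t => √(1 - (t - p) ^ 2) - √(1 - (t - p') ^ 2)) z =
        -((z - p) / √(1 - (z - p) ^ 2)) - -((z - p') / √(1 - (z - p') ^ 2)) := h3
      rw [h5]
      linarith
  exact hm (Set.left_mem_Icc.mpr hxy.le) (Set.right_mem_Icc.mpr hxy.le) hxy

/-- the upper semicircle function -/
def arcF (q : Plane) (x : ℝ) : ℝ := q 1 + √(1 - (x - q 0) ^ 2)

lemma arcF_gt_iff {q : Plane} {y₀ x : ℝ} (hq : q 1 ≤ y₀) :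
    y₀ < arcF q x ↔ 0 < (1 - (y₀ - q 1) ^ 2) - (x - q 0) ^ 2 := by
  have : y₀ < arcF q x ↔ y₀ - q 1 < √(1 - (x - q 0) ^ 2) := by
    unfold arcF; constructor <;> intro h <;> linarith
  rw [this, Real.lt_sqrt (by linarith)]
  constructor <;> intro h <;> linarith

lemma arcF_dom {q : Plane} {y₀ x : ℝ} (hq : q 1 ≤ y₀) (h : y₀ < arcF q x) :
    0 < 1 - (x - q 0) ^ 2 := by
  have := (arcF_gt_iff hq).mp h
  nlinarith [sq_nonneg (y₀ - q 1)]

lemma plane_ext {q q' : Plane} (h0 : q 0 = q' 0) (h1 : q 1 = q' 1) : q = q' := by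
  ext i; fin_cases i
  · exact h0
  · exact h1

lemma arcF_uniq {y₀ : ℝ} {q q' : Plane} (hq : q 1 ≤ y₀) (hq' : q' 1 ≤ y₀) (hne : q ≠ q')
    {x y : ℝ} (hx : y₀ < arcF q x) (hy : y₀ < arcF q y) (ex : arcF q x = arcF q' x)
    (ey : arcF q y = arcF q' y) : ¬ x < y := by
  intro hxy
  have hx' : y₀ < arcF q' x := ex ▸ hx
  have hy' : y₀ < arcF q' y := ey ▸ hy
  have a := arcF_dom hq hx
  have b := arcF_dom hq hy
  have c := arcF_dom hq' hx'
  have d := arcF_dom hq' hy'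
  unfold arcF at ex ey
  rcases lt_trichotomy (q 0) (q' 0) with h | h | h
  · have := diff_strictMono h hxy c d a b
    linarith
  · rw [h] at ex
    exact hne (plane_ext h (by linarith))
  · have := diff_strictMono h hxy a b c d
    linarith

lemma arcF_ord {y₀ : ℝ} {q q' : Plane} (hq : q 1 ≤ y₀) (hq' : q' 1 ≤ y₀) :
    {x | y₀ < arcF q x ∧ arcF q x < arcF q' x}.OrdConnected := by
  refine ⟨?_⟩
  rintro x ⟨hx, hxl⟩ y ⟨hy, hyl⟩ z ⟨h1, h2⟩
  have hz : y₀ < arcF q z :=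
    (arcF_gt_iff hq).mpr (conv_dom ((arcF_gt_iff hq).mp hx) ((arcF_gt_iff hq).mp hy) h1 h2)
  refine ⟨hz, ?_⟩
  have hx' : y₀ < arcF q' x := hx.trans hxl
  have hy' : y₀ < arcF q' y := hy.trans hyl
  have a := arcF_dom hq hx
  have b := arcF_dom hq hy
  have c := arcF_dom hq' hx'
  have d := arcF_dom hq' hy'
  have e := conv_dom a b h1 h2
  have f := conv_dom c d h1 h2
  rcases h1.eq_or_lt with h | h1
  · rw [← h]; exact hxl
  rcases h2.eq_or_lt with h | h2
  · rw [h]; exact hyl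
  unfold arcF at hxl hyl ⊢
  rcases lt_trichotomy (q 0) (q' 0) with h | h | h
  · have := diff_strictMono h h1 c f a e
    linarith
  · rw [h] at hxl ⊢; linarith
  · have := diff_strictMono h h2 e b f d
    linarith

/-- The concrete system of arcs. -/
def sys (y₀ : ℝ) (Q : Finset Plane) : ArcSys {q : Plane // q 1 ≤ y₀} where
  G := fun q => arcF q.1
  y₀ := y₀
  Q := Q.subtype (fun q => q 1 ≤ y₀)
  cont := fun q => by unfold arcF; fun_prop
  ord := fun i j => arcF_ord i.2 j.2
  uniq := fun i j hij x y hx hy ex ey => by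
    have hne : i.1 ≠ j.1 := fun h => hij (Subtype.ext h)
    rcases lt_trichotomy x y with h | h | h
    · exact absurd h (arcF_uniq i.2 j.2 hne hx hy ex ey)
    · exact h
    · exact absurd h (arcF_uniq i.2 j.2 hne hy hx ey ex)

lemma dist_sq_plane (z q : Plane) : dist z q = √((z 0 - q 0) ^ 2 + (z 1 - q 1) ^ 2) := by
  rw [EuclideanSpace.dist_eq, Fin.sum_univ_two, Real.dist_eq, Real.dist_eq, sq_abs, sq_abs]

lemma dist_one_iff (z q : Plane) : dist z q = 1 ↔ (z 0 - q 0) ^ 2 + (z 1 - q 1) ^ 2 = 1 := by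
  rw [dist_sq_plane, Real.sqrt_eq_one]

lemma eq_arcF {z q : Plane} (h : dist z q = 1) (hz : q 1 ≤ z 1) : z 1 = arcF q (z 0) := by
  rw [dist_one_iff] at h
  unfold arcF
  rw [show 1 - (z 0 - q 0) ^ 2 = (z 1 - q 1) ^ 2 by linarith, Real.sqrt_sq (by linarith)]
  ring

lemma dist_arcF {y₀ x : ℝ} {q : Plane} (hq : q 1 ≤ y₀) (h : y₀ < arcF q x) :
    dist (!₂[x, arcF q x] : Plane) q = 1 := by
  rw [dist_one_iff]
  have := arcF_dom hq h
  simp only [arcF, Matrix.cons_val_zero, Matrix.cons_val_one, add_sub_cancel_left]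
  rw [Real.sq_sqrt this.le]
  ring

/-! ### Regions -/

variable (A)

def region (σ : Cell ι) : Set Plane :=
  {z | σ.u ≤ z 0 ∧ z 0 ≤ σ.v ∧ low A σ.lo (z 0) ≤ z 1 ∧ z 1 ≤ A.G σ.hi (z 0)}

def oreg (σ : Cell ι) : Set Plane :=
  {z | σ.u < z 0 ∧ z 0 < σ.v ∧ low A σ.lo (z 0) < z 1 ∧ z 1 < A.G σ.hi (z 0)}

variable {A}

lemma oreg_sub_region (σ : Cell ι) : oreg A σ ⊆ region A σ :=
  fun _ h => ⟨h.1.le, h.2.1.le, h.2.2.1.le, h.2.2.2.le⟩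

lemma oreg_open (σ : Cell ι) : IsOpen (oreg A σ) := by
  have c0 : Continuous (fun z : Plane => z 0) := by fun_prop
  have c1 : Continuous (fun z : Plane => z 1) := by fun_prop
  exact (isOpen_lt continuous_const c0).inter ((isOpen_lt c0 continuous_const).inter
    ((isOpen_lt ((low_cont σ.lo).comp c0) c1).inter (isOpen_lt c1 ((A.cont σ.hi).comp c0))))

lemma oreg_sub_interior (σ : Cell ι) : oreg A σ ⊆ interior (region A σ) :=
  interior_maximal (oreg_sub_region σ) (oreg_open σ)

lemma interior_perturb {S : Set Plane} {z : Plane} (hz : z ∈ interior S) (i : Fin 2) :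
    ∃ ε > 0, z + (ε : ℝ) • EuclideanSpace.single i (1 : ℝ) ∈ S ∧
      z + (-ε : ℝ) • EuclideanSpace.single i (1 : ℝ) ∈ S := by
  have hc : Continuous (fun t : ℝ => z + t • EuclideanSpace.single i (1 : ℝ)) := by fun_prop
  have ho : IsOpen ((fun t : ℝ => z + t • EuclideanSpace.single i (1 : ℝ)) ⁻¹' interior S) :=
    isOpen_interior.preimage hc
  obtain ⟨ε, hε, hb⟩ := Metric.isOpen_iff.mp ho 0 (by simpa using hz)
  refine ⟨ε / 2, by positivity, interior_subset (hb ?_), interior_subset (hb ?_)⟩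
  · rw [Metric.mem_ball, Real.dist_eq, abs_lt]; constructor <;> linarith
  · rw [Metric.mem_ball, Real.dist_eq, abs_lt]; constructor <;> linarith

lemma interior_sub_oreg (σ : Cell ι) : interior (region A σ) ⊆ oreg A σ := by
  intro z hz
  obtain ⟨ε, hε, ha, hb⟩ := interior_perturb hz 0
  obtain ⟨η, hη, hc, hd⟩ := interior_perturb hz 1
  have ha2 := ha.2.1
  have hb1 := hb.1
  have hc4 := hc.2.2.2
  have hd3 := hd.2.2.1
  simp at ha2 hb1 hc4 hd3
  exact ⟨by linarith, by linarith, by linarith, by linarith⟩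

lemma oreg_nonempty {σ : Cell ι} (hv : Valid A σ) : (oreg A σ).Nonempty := by
  have huv := hv.uv
  set x := (σ.u + σ.v) / 2 with hx
  have h1 : σ.u < x := by rw [hx]; linarith
  have h2 : x < σ.v := by rw [hx]; linarith
  have h3 := hv.lo_hi x h1 h2
  refine ⟨!₂[x, (low A σ.lo x + A.G σ.hi x) / 2], ?_⟩
  refine ⟨by simpa using h1, by simpa using h2, ?_, ?_⟩
  · simp; linarith
  · simp; linarith

lemma le_Icc {f g : ℝ → ℝ} (hf : Continuous f) (hg : Continuous g) {u v : ℝ} (huv : u < v)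
    (h : ∀ x, u < x → x < v → f x < g x) {x : ℝ} (h1 : u ≤ x) (h2 : x ≤ v) : f x ≤ g x := by
  refine le_on_closure (s := Set.Ioo u v) (fun y hy => (h y hy.1 hy.2).le) hf.continuousOn
    hg.continuousOn ?_
  rw [closure_Ioo huv.ne]
  exact ⟨h1, h2⟩

lemma Sub.region_sub {σ : Cell ι} {L : List (Cell ι)} (h : Sub A σ L) (hv : Valid A σ) :
    (∀ τ ∈ L, region A τ ⊆ region A σ) ∧ (∀ τ ∈ L, oreg A τ ⊆ oreg A σ) := by
  induction h with
  | refl σ => simp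
  | vs σ w L₁ L₂ h1 h2 _ _ ih1 ih2 =>
    obtain ⟨a1, b1⟩ := ih1 (hv.lft h1 h2)
    obtain ⟨a2, b2⟩ := ih2 (hv.rgt h1 h2)
    constructor
    · intro τ hτ
      rcases List.mem_append.mp hτ with h | h
      · exact (a1 τ h).trans (fun z hz => ⟨hz.1, le_trans hz.2.1 h2.le, hz.2.2⟩)
      · exact (a2 τ h).trans (fun z hz => ⟨h1.le.trans hz.1, hz.2⟩)
    · intro τ hτ
      rcases List.mem_append.mp hτ with h | h
      · exact (b1 τ h).trans (fun z hz => ⟨hz.1, lt_trans hz.2.1 h2, hz.2.2⟩)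
      · exact (b2 τ h).trans (fun z hz => ⟨h1.trans hz.1, hz.2⟩)
  | hs σ c L₁ L₂ hc _ _ ih1 ih2 =>
    obtain ⟨a1, b1⟩ := ih1 (hv.bot hc)
    obtain ⟨a2, b2⟩ := ih2 (hv.upp hc)
    constructor
    · intro τ hτ
      rcases List.mem_append.mp hτ with h | h
      · exact (a1 τ h).trans (fun z hz => ⟨hz.1, hz.2.1, hz.2.2.1, hz.2.2.2.trans
          (le_Icc (A.cont c) (A.cont σ.hi) hv.uv (fun x p q => (hc x p q).2.2.2) hz.1 hz.2.1)⟩)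
      · exact (a2 τ h).trans (fun z hz => ⟨hz.1, hz.2.1,
          (le_Icc (low_cont σ.lo) (A.cont c) hv.uv (fun x p q => (hc x p q).2.2.1)
            hz.1 hz.2.1).trans hz.2.2.1, hz.2.2.2⟩)
    · intro τ hτ
      rcases List.mem_append.mp hτ with h | h
      · exact (b1 τ h).trans (fun z hz => ⟨hz.1, hz.2.1, hz.2.2.1, hz.2.2.2.trans
          (hc _ hz.1 hz.2.1).2.2.2⟩)
      · exact (b2 τ h).trans (fun z hz => ⟨hz.1, hz.2.1,
          (hc _ hz.1 hz.2.1).2.2.1.trans hz.2.2.1, hz.2.2.2⟩)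

lemma Sub.cover {σ : Cell ι} {L : List (Cell ι)} (h : Sub A σ L) :
    ∀ z ∈ region A σ, ∃ τ ∈ L, z ∈ region A τ := by
  induction h with
  | refl σ => intro z hz; exact ⟨σ, by simp, hz⟩
  | vs σ w L₁ L₂ h1 h2 _ _ ih1 ih2 =>
    intro z hz
    rcases le_total (z 0) w with h | h
    · obtain ⟨τ, hτ, hm⟩ := ih1 z ⟨hz.1, h, hz.2.2⟩
      exact ⟨τ, List.mem_append_left _ hτ, hm⟩
    · obtain ⟨τ, hτ, hm⟩ := ih2 z ⟨h, hz.2⟩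
      exact ⟨τ, List.mem_append_right _ hτ, hm⟩
  | hs σ c L₁ L₂ hc _ _ ih1 ih2 =>
    intro z hz
    rcases le_total (z 1) (A.G c (z 0)) with h | h
    · obtain ⟨τ, hτ, hm⟩ := ih1 z ⟨hz.1, hz.2.1, hz.2.2.1, h⟩
      exact ⟨τ, List.mem_append_left _ hτ, hm⟩
    · obtain ⟨τ, hτ, hm⟩ := ih2 z ⟨hz.1, hz.2.1, h, hz.2.2.2⟩
      exact ⟨τ, List.mem_append_right _ hτ, hm⟩

lemma Sub.disj {σ : Cell ι} {L : List (Cell ι)} (h : Sub A σ L) (hv : Valid A σ) :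
    L.Pairwise (fun τ τ' => Disjoint (oreg A τ) (oreg A τ')) := by
  induction h with
  | refl σ => simp
  | vs σ w L₁ L₂ h1 h2 s1 s2 ih1 ih2 =>
    rw [List.pairwise_append]
    refine ⟨ih1 (hv.lft h1 h2), ih2 (hv.rgt h1 h2), fun a ha b hb => ?_⟩
    rw [Set.disjoint_left]
    intro z hz hz'
    have p := (s1.region_sub (hv.lft h1 h2)).2 a ha hz
    have q := (s2.region_sub (hv.rgt h1 h2)).2 b hb hz'
    exact lt_asymm (show z 0 < w from p.2.1) q.1
  | hs σ c L₁ L₂ hc s1 s2 ih1 ih2 =>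
    rw [List.pairwise_append]
    refine ⟨ih1 (hv.bot hc), ih2 (hv.upp hc), fun a ha b hb => ?_⟩
    rw [Set.disjoint_left]
    intro z hz hz'
    have p := (s1.region_sub (hv.bot hc)).2 a ha hz
    have q := (s2.region_sub (hv.upp hc)).2 b hb hz'
    exact lt_asymm (show z 1 < A.G c (z 0) from p.2.2.2) q.2.2.1

lemma Sub.disj' {σ : Cell ι} {L : List (Cell ι)} (h : Sub A σ L) (hv : Valid A σ)
    {τ τ' : Cell ι} (h1 : τ ∈ L) (h2 : τ' ∈ L) (hne : τ ≠ τ') :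
    Disjoint (oreg A τ) (oreg A τ') := by
  have : Std.Symm (fun τ τ' => Disjoint (oreg A τ) (oreg A τ')) := ⟨fun _ _ h => h.symm⟩
  exact (h.disj hv).forall h1 h2 hne

/-! ### The hierarchy -/

lemma Xset_le (σ : Cell ι) : (Xset A σ).card ≤ (M A σ).card * (M A σ).card := by
  rw [← Finset.card_product]
  refine Finset.card_le_card (fun p hp => ?_)
  simp only [Xset, Finset.mem_filter, Finset.mem_product] at hp
  obtain ⟨⟨h1, h2⟩, hne, x, hx, he⟩ := hp
  simp only [M, Finset.mem_product, Finset.mem_filter]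
  refine ⟨⟨h1, x, hx⟩, h2, x, hx.1, hx.2.1, ?_, ?_⟩
  · rw [← he]; exact hx.2.2.1
  · rw [← he]; exact hx.2.2.2

lemma geom_bound (a : ℝ) (ha : 2 ≤ a) (k : ℕ) : ∑ i ∈ Finset.range (k + 1), a ^ i ≤ 2 * a ^ k := by
  induction k with
  | zero => simp
  | succ k ih =>
    rw [Finset.sum_range_succ, pow_succ]
    have : 0 < a ^ k := by positivity
    nlinarith

lemma hierarchy (ρ θ : ℝ) (hρ : 2 ≤ ρ) (hθ : 0 < θ) (hθρ : 512 * θ * ρ ≤ 1)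
    (D : ℕ) (hθD : 176 * θ * D ≤ 1) (hD : 16 * ρ ≤ 2 ^ D) (a : ℝ)
    (ha : a = 1 + 32 * ρ + 176 * D * ρ) (ha2 : 2 * a ≤ ρ ^ 2) (n : ℝ) (hn : 0 < n)
    (T : Cell ι) (hv : Valid A T) (hM : ((M A T).card : ℝ) ≤ n) :
    ∃ (F : ℕ → Cell ι → List (Cell ι)) (Λ : ℕ → List (Cell ι)), Λ 0 = [T] ∧
      (∀ i, Λ (i + 1) = (Λ i).flatMap (F i)) ∧ (∀ i, Sub A T (Λ i)) ∧
      (∀ i, ∀ τ ∈ Λ i, ((M A τ).card : ℝ) ≤ n / ρ ^ i) ∧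
      (∀ i, ∀ τ ∈ Λ i, Sub A τ (F i τ) ∧ ((F i τ).length : ℝ) ≤ a * (1 + 16 * ρ ^ 2 / θ)) ∧
      (∀ i, ((Λ i).length : ℝ) ≤ a ^ i + 2 * (16 * a / θ * (Xset A T).card / n ^ 2) * (ρ ^ 2) ^ i) := by
  have hρ0 : 0 < ρ := by linarith
  have ha0 : 0 < a := by rw [ha]; positivity
  have hF : ∀ (i : ℕ) (σ : Cell ι), ∃ L, (Valid A σ ∧ ((M A σ).card : ℝ) ≤ n / ρ ^ i) →
      Sub A σ L ∧ (∀ τ ∈ L, ((M A τ).card : ℝ) ≤ n / ρ ^ (i + 1)) ∧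
      (L.length : ℝ) ≤ a * (1 + (Xset A σ).card / (θ / 16 * (n / ρ ^ (i + 1)) ^ 2)) := by
    intro i σ
    by_cases h : Valid A σ ∧ ((M A σ).card : ℝ) ≤ n / ρ ^ i
    · obtain ⟨L, hL⟩ := one_step (A := A) (n / ρ ^ (i + 1)) ρ θ (by positivity) hρ0.le hθ hθρ D
        hθD hD σ h.1 (by
          refine h.2.trans (le_of_eq ?_)
          rw [pow_succ]; field_simp)
      exact ⟨L, fun _ => by rw [ha]; exact hL⟩
    · exact ⟨[], fun h' => absurd h' h⟩
  choose F hF using hF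
  let Λ : ℕ → List (Cell ι) := fun i => Nat.rec [T] (fun i L => L.flatMap (F i)) i
  have hΛ0 : Λ 0 = [T] := rfl
  have hΛs : ∀ i, Λ (i + 1) = (Λ i).flatMap (F i) := fun i => rfl
  have key : ∀ i, Sub A T (Λ i) ∧ ∀ τ ∈ Λ i, ((M A τ).card : ℝ) ≤ n / ρ ^ i := by
    intro i
    induction i with
    | zero =>
      rw [hΛ0]
      refine ⟨Sub.refl T, fun τ hτ => ?_⟩
      rw [List.mem_singleton.mp hτ]; simpa using hM
    | succ i ih =>
      obtain ⟨h1, h2⟩ := ih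
      rw [hΛs]
      refine ⟨h1.flatMap _ (fun τ hτ => (hF i τ ⟨h1.valid hv τ hτ, h2 τ hτ⟩).1), fun τ hτ => ?_⟩
      obtain ⟨s, hs, hτs⟩ := List.mem_flatMap.mp hτ
      exact (hF i s ⟨h1.valid hv s hs, h2 s hs⟩).2.1 τ hτs
  refine ⟨F, Λ, hΛ0, hΛs, fun i => (key i).1, fun i => (key i).2, ?_, ?_⟩
  · intro i τ hτ
    obtain ⟨h1, h2⟩ := key i
    have h3 := hF i τ ⟨h1.valid hv τ hτ, h2 τ hτ⟩
    refine ⟨h3.1, h3.2.2.trans (mul_le_mul_of_nonneg_left ?_ ha0.le)⟩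
    have hX : ((Xset A τ).card : ℝ) ≤ (n / ρ ^ i) ^ 2 := by
      have : ((Xset A τ).card : ℝ) ≤ (M A τ).card * (M A τ).card := by exact_mod_cast Xset_le τ
      have h4 := h2 τ hτ
      have h5 : (0 : ℝ) ≤ (M A τ).card := Nat.cast_nonneg _
      nlinarith
    have hpos : 0 < θ / 16 * (n / ρ ^ (i + 1)) ^ 2 := by positivity
    have : ((Xset A τ).card : ℝ) / (θ / 16 * (n / ρ ^ (i + 1)) ^ 2) ≤ 16 * ρ ^ 2 / θ := by
      rw [div_le_iff₀ hpos]
      refine hX.trans (le_of_eq ?_)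
      rw [pow_succ]; field_simp; ring
    linarith
  · intro i
    set B := 16 * a / θ * (Xset A T).card / n ^ 2 with hB
    have hB0 : 0 ≤ B := by positivity
    induction i with
    | zero => rw [hΛ0]; simp; exact hB0
    | succ i ih =>
      obtain ⟨h1, h2⟩ := key i
      have hle := length_flatMap_le (Λ i) (F i)
        (fun τ => a + a / (θ / 16 * (n / ρ ^ (i + 1)) ^ 2) * ((Xset A τ).card : ℝ)) (by
          intro τ hτ
          refine (hF i τ ⟨h1.valid hv τ hτ, h2 τ hτ⟩).2.2.trans (le_of_eq ?_)
          ring)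
      rw [list_sum_affine] at hle
      rw [hΛs]
      have hX := h1.X_sum hv
      have hpos : 0 ≤ a / (θ / 16 * (n / ρ ^ (i + 1)) ^ 2) := by positivity
      have h4 := mul_le_mul_of_nonneg_left hX hpos
      have h5 : a / (θ / 16 * (n / ρ ^ (i + 1)) ^ 2) * ((Xset A T).card : ℝ) =
          B * (ρ ^ 2) ^ (i + 1) := by
        rw [hB]; field_simp; ring
      have h6 := mul_le_mul_of_nonneg_left ih ha0.le
      have h7 : 0 ≤ B * (ρ ^ 2) ^ i := by positivity
      have h8 := mul_le_mul_of_nonneg_right ha2 h7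
      have h9 : (ρ ^ 2) ^ (i + 1) = (ρ ^ 2) ^ i * ρ ^ 2 := pow_succ _ _
      have h10 : a ^ (i + 1) = a ^ i * a := pow_succ _ _
      rw [h9] at h5 ⊢
      rw [h10]
      nlinarith

lemma sum_bound (a ρ B : ℝ) (ha : 2 ≤ a) (hρ : 2 ≤ ρ) (hB : 0 ≤ B) (N : ℕ → ℝ)
    (hN : ∀ i, N i ≤ a ^ i + 2 * B * (ρ ^ 2) ^ i) (k : ℕ) :
    ∑ i ∈ Finset.range (k + 1), N i ≤ 2 * a ^ k + 4 * B * (ρ ^ 2) ^ k := by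
  have h1 := geom_bound a ha k
  have h2 := geom_bound (ρ ^ 2) (by nlinarith) k
  calc ∑ i ∈ Finset.range (k + 1), N i
      ≤ ∑ i ∈ Finset.range (k + 1), (a ^ i + 2 * B * (ρ ^ 2) ^ i) :=
        Finset.sum_le_sum (fun i _ => hN i)
    _ = ∑ i ∈ Finset.range (k + 1), a ^ i + 2 * B * ∑ i ∈ Finset.range (k + 1), (ρ ^ 2) ^ i := by
        rw [Finset.sum_add_distrib, Finset.mul_sum]
    _ ≤ _ := by
        have := mul_le_mul_of_nonneg_left h2 (show 0 ≤ 2 * B by linarith)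
        linarith

/-- Choice of constants. -/
lemma constants (δ : ℝ) (hδ : 0 < δ) : ∃ (ρ θ a : ℝ) (D : ℕ), 2 ≤ ρ ∧ 0 < θ ∧ 512 * θ * ρ ≤ 1 ∧
    176 * θ * D ≤ 1 ∧ 16 * ρ ≤ 2 ^ D ∧ a = 1 + 32 * ρ + 176 * D * ρ ∧ 2 * a ≤ ρ ^ 2 ∧ 2 ≤ a ∧
    a ≤ ρ ^ (1 + δ) := by
  have ev : ∀ b : ℝ, 1 < b → ∀ᶠ p : ℕ in Filter.atTop, 2 * (737 + 176 * (p : ℝ)) ≤ b ^ p := by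
    intro b hb
    have h1 := tendsto_pow_const_div_const_pow_of_one_lt 1 hb
    have h2 := h1.eventually (gt_mem_nhds (show (0 : ℝ) < 1 / 1826 by norm_num))
    filter_upwards [h2, Filter.eventually_ge_atTop 1] with p hp hp1
    have hbp : 0 < b ^ p := by positivity
    rw [div_lt_div_iff₀ hbp (by norm_num)] at hp
    have : (1 : ℝ) ≤ p := by exact_mod_cast hp1
    simp only [pow_one] at hp
    linarith
  have hδ2 : (1 : ℝ) < 2 ^ δ := Real.one_lt_rpow (by norm_num) hδ
  obtain ⟨p, ⟨hp1, hp2⟩, hp3⟩ := ((ev _ hδ2).and (ev 2 (by norm_num))).and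
    (Filter.eventually_ge_atTop 1) |>.exists
  have hp3' : (1 : ℝ) ≤ p := by exact_mod_cast hp3
  set ρ : ℝ := 2 ^ p with hρ
  have hρ2 : 2 ≤ ρ := by
    calc (2 : ℝ) = 2 ^ 1 := by norm_num
      _ ≤ 2 ^ p := pow_le_pow_right₀ (by norm_num) hp3
  have hρ0 : 0 < ρ := by linarith
  have hDc : (((p + 4 : ℕ)) : ℝ) = p + 4 := by push_cast; ring
  have hden : 0 < 512 * ρ + 176 * ((p + 4 : ℕ) : ℝ) := by positivity
  have hale : 1 + 32 * ρ + 176 * ((p + 4 : ℕ) : ℝ) * ρ ≤ ρ * (737 + 176 * p) := by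
    rw [hDc]; nlinarith
  refine ⟨ρ, 1 / (512 * ρ + 176 * ((p + 4 : ℕ) : ℝ)), _, p + 4, hρ2, by positivity, ?_, ?_, ?_, rfl,
    ?_, ?_, ?_⟩
  · rw [mul_one_div, div_mul_eq_mul_div, div_le_one hden]
    have : (0 : ℝ) ≤ ((p + 4 : ℕ) : ℝ) := Nat.cast_nonneg _
    linarith
  · rw [mul_one_div, div_mul_eq_mul_div, div_le_one hden]
    linarith
  · rw [pow_add, ← hρ]; linarith
  · nlinarith
  · have : 0 ≤ 176 * ((p + 4 : ℕ) : ℝ) * ρ := by positivity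
    linarith
  · refine hale.trans ?_
    rw [Real.rpow_add hρ0, Real.rpow_one]
    refine mul_le_mul_of_nonneg_left ?_ hρ0.le
    have : ρ ^ δ = ((2 : ℝ) ^ δ) ^ p := by
      rw [hρ, ← Real.rpow_natCast, ← Real.rpow_mul (by norm_num), mul_comm,
        Real.rpow_mul (by norm_num), Real.rpow_natCast]
    rw [this]
    have : (0:ℝ) ≤ 737 + 176 * p := by positivity
    linarith

lemma k_bound (ρ r : ℝ) (hρ : 2 ≤ ρ) (hr : 1 ≤ r) : ρ ^ ⌈Real.logb ρ r⌉₊ ≤ ρ * r := by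
  have h0 : 0 ≤ Real.logb ρ r := Real.logb_nonneg (by linarith) hr
  have h1 := (Nat.ceil_lt_add_one h0).le
  rw [← Real.rpow_natCast]
  calc ρ ^ ((⌈Real.logb ρ r⌉₊ : ℕ) : ℝ) ≤ ρ ^ (Real.logb ρ r + 1) :=
        Real.rpow_le_rpow_of_exponent_le (by linarith) h1
    _ = ρ * r := by
        rw [Real.rpow_add (by linarith), Real.rpow_one,
          Real.rpow_logb (by linarith) (by linarith) (by linarith)]
        ring

lemma final_bound (δ ρ θ a r X χ n S : ℝ) (k : ℕ) (hδ : 0 < δ) (hρ : 2 ≤ ρ) (hθ : 0 < θ)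
    (ha : 2 ≤ a) (haρ : a ≤ ρ ^ (1 + δ)) (hr : 1 ≤ r) (hk : ρ ^ k ≤ ρ * r) (hX : X ≤ 2 * χ)
    (hX0 : 0 ≤ X) (hn : 0 < n)
    (hS : S ≤ 2 * a ^ k + 4 * (16 * a / θ * X / n ^ 2) * (ρ ^ 2) ^ k) :
    S ≤ (2 * ρ ^ (1 + δ) + 128 * a / θ * ρ ^ 2 + a * (1 + 16 * ρ ^ 2 / θ)) *
      (r ^ (1 + δ) + χ * r ^ 2 / n ^ 2) := by
  have hρ0 : 0 < ρ := by linarith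
  have hr0 : 0 < r := by linarith
  have hχ : 0 ≤ χ := by linarith
  have h1 : a ^ k ≤ ρ ^ (1 + δ) * r ^ (1 + δ) := by
    calc a ^ k ≤ (ρ ^ (1 + δ)) ^ k := pow_le_pow_left₀ (by linarith) haρ k
      _ = (ρ ^ k) ^ (1 + δ) := by
          rw [← Real.rpow_natCast, ← Real.rpow_mul hρ0.le, mul_comm, Real.rpow_mul hρ0.le,
            Real.rpow_natCast]
      _ ≤ (ρ * r) ^ (1 + δ) := Real.rpow_le_rpow (by positivity) hk (by linarith)
      _ = _ := Real.mul_rpow hρ0.le hr0.le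
  have h2 : (ρ ^ 2) ^ k ≤ ρ ^ 2 * r ^ 2 := by
    calc (ρ ^ 2) ^ k = (ρ ^ k) ^ 2 := by rw [← pow_mul, ← pow_mul, mul_comm]
      _ ≤ (ρ * r) ^ 2 := pow_le_pow_left₀ (by positivity) hk 2
      _ = _ := by ring
  have h3 : 4 * (16 * a / θ * X / n ^ 2) * (ρ ^ 2) ^ k ≤
      4 * (16 * a / θ * (2 * χ) / n ^ 2) * (ρ ^ 2 * r ^ 2) := by
    have ha0 : 0 < a := by linarith
    gcongr
  have h4 : 4 * (16 * a / θ * (2 * χ) / n ^ 2) * (ρ ^ 2 * r ^ 2) =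
      (128 * a / θ * ρ ^ 2) * (χ * r ^ 2 / n ^ 2) := by ring
  have ha0 : 0 < a := by linarith
  have p1 : 0 ≤ r ^ (1 + δ) := by positivity
  have p2 : 0 ≤ χ * r ^ 2 / n ^ 2 := by positivity
  have p3 : 0 ≤ ρ ^ (1 + δ) := by positivity
  have p4 : 0 ≤ 128 * a / θ * ρ ^ 2 := by positivity
  have p5 : 0 ≤ a * (1 + 16 * ρ ^ 2 / θ) := by positivity
  have q1 := mul_nonneg p3 p2
  have q2 := mul_nonneg p4 p1
  have q3 := mul_nonneg p5 (add_nonneg p1 p2)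
  rw [h4] at h3
  nlinarith

/-! ### The concrete configuration -/

lemma gs_pos : 0 < gs := by unfold gs; positivity

lemma gs_sq : gs ^ 2 = 1 / 2 := by
  unfold gs; rw [div_pow, Real.sq_sqrt (by norm_num)]; norm_num

lemma gs_le : gs ≤ √(7 / 8) := by
  rw [← Real.sqrt_sq gs_pos.le, gs_sq]
  exact Real.sqrt_le_sqrt (by norm_num)

/-- The cell describing the extended cell. -/
def topCell (x₀ y₀ : ℝ) : Cell {q : Plane // q 1 ≤ y₀} where
  u := x₀
  v := x₀ + gs
  lo := none
  hi := ⟨!₂[x₀ + gs / 2, y₀ + gs - √(7 / 8)], by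
    have := gs_le
    simp only [Matrix.cons_val_one, Matrix.cons_val_fin_one]
    linarith⟩

lemma topCell_G (x₀ y₀ : ℝ) (Q : Finset Plane) (x : ℝ) : (sys y₀ Q).G (topCell x₀ y₀).hi x =
    (y₀ + gs - √(7 / 8)) + √(1 - (x - x₀ - gs / 2) ^ 2) := by
  simp only [sys, topCell, arcF, Matrix.cons_val_zero, Matrix.cons_val_one,
    Matrix.cons_val_fin_one]
  rw [sub_sub]

lemma topCell_region (x₀ y₀ : ℝ) (Q : Finset Plane) :
    region (sys y₀ Q) (topCell x₀ y₀) = ExtCell x₀ y₀ := by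
  ext z
  simp only [region, ExtCell, Set.mem_ofPred_eq, topCell_G]
  exact Iff.rfl

lemma topCell_valid (x₀ y₀ : ℝ) (Q : Finset Plane) : Valid (sys y₀ Q) (topCell x₀ y₀) where
  uv := by have := gs_pos; simp only [topCell]; linarith
  lo_hi := by
    intro x h1 h2
    rw [topCell_G]
    change x₀ < x at h1
    change x < x₀ + gs at h2
    have h3 : √(7 / 8) ≤ √(1 - (x - x₀ - gs / 2) ^ 2) := by
      apply Real.sqrt_le_sqrt
      have := gs_sq
      nlinarith
    have := gs_pos
    change y₀ < _
    linarith
  floor := by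
    intro i h
    simp [topCell] at h

lemma region_trap {x₀ y₀ : ℝ} {Q : Finset Plane} {σ : Cell {q : Plane // q 1 ≤ y₀}}
    (hv : Valid (sys y₀ Q) σ) (hs : region (sys y₀ Q) σ ⊆ ExtCell x₀ y₀) :
    IsPseudoTrapezoid x₀ y₀ (region (sys y₀ Q) σ) := by
  refine ⟨σ.u, σ.v, low (sys y₀ Q) σ.lo, (sys y₀ Q).G σ.hi, hv.uv.le, ⟨σ.hi.1, σ.hi.2, fun x => rfl⟩,
    ?_, fun x h1 h2 => le_Icc (low_cont _) ((sys y₀ Q).cont _) hv.uv hv.lo_hi h1 h2, ?_⟩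
  · rcases σ.lo with _ | i
    · left; intro x; rfl
    · right; exact ⟨i.1, i.2, fun x => rfl⟩
  · ext z
    exact ⟨fun h => ⟨hs h, h⟩, fun h => h.2⟩

lemma sys_card {x₁ y₁ y₀ : ℝ} {Q : Finset Plane} (hy : y₁ + gs ≤ y₀)
    (hQ : ∀ q ∈ Q, q ∈ Square x₁ y₁) : (sys y₀ Q).Q.card = Q.card := by
  simp only [sys, Finset.card_subtype]
  rw [Finset.filter_true_of_mem]
  intro q hq
  exact (hQ q hq).2.2.2.trans hy

lemma M_le_card (σ : Cell ι) : (M A σ).card ≤ A.Q.card :=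
  Finset.card_le_card (Finset.filter_subset _ _)

lemma crossed_le {x₀ y₀ : ℝ} {Q : Finset Plane} (hQ : ∀ q ∈ Q, q 1 ≤ y₀)
    (σ : Cell {q : Plane // q 1 ≤ y₀}) :
    {q : Plane | q ∈ Q ∧ (UpperArc x₀ y₀ q ∩ interior (region (sys y₀ Q) σ)).Nonempty}.ncard ≤
      (M (sys y₀ Q) σ).card := by
  rw [← Finset.card_map (Function.Embedding.subtype _), ← Set.ncard_coe_finset]
  refine Set.ncard_le_ncard ?_ (Finset.finite_toSet _)
  rintro q ⟨hq, z, ⟨hd, hz⟩, hi⟩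
  have ho := interior_sub_oreg _ hi
  have hz1 : q 1 ≤ z 1 := (hQ q hq).trans hz.2.2.1
  have he := eq_arcF hd hz1
  simp only [Finset.coe_map, Set.mem_image, Finset.mem_coe]
  refine ⟨⟨q, hQ q hq⟩, ?_, rfl⟩
  simp only [M, Finset.mem_filter]
  refine ⟨by simp [sys, hq], z 0, ho.1, ho.2.1, ?_, ?_⟩
  · change _ < arcF q (z 0)
    rw [← he]; exact ho.2.2.1
  · change arcF q (z 0) < _
    rw [← he]; exact ho.2.2.2

lemma X_le_chi (x₀ y₀ : ℝ) (Q : Finset Plane) :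
    (Xset (sys y₀ Q) (topCell x₀ y₀)).card ≤ 2 * {e : Set Plane | ∃ q ∈ Q, ∃ q' ∈ Q, q ≠ q' ∧
          e = {q, q'} ∧ (UpperArc x₀ y₀ q ∩ UpperArc x₀ y₀ q').Nonempty}.ncard := by
  set f : {q : Plane // q 1 ≤ y₀} × {q : Plane // q 1 ≤ y₀} → Set Plane :=
    fun p => {p.1.1, p.2.1} with hf
  have h1 := Finset.card_le_mul_card_image (f := f) (Xset (sys y₀ Q) (topCell x₀ y₀)) 2 (by
    intro e he
    obtain ⟨p, hp, rfl⟩ := Finset.mem_image.mp he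
    refine le_trans (Finset.card_le_card (t := {p, (p.2, p.1)}) ?_) Finset.card_le_two
    intro p' hp'
    have h := (Finset.mem_filter.mp hp').2
    simp only [hf] at h
    rw [Set.pair_eq_pair_iff] at h
    simp only [Finset.mem_insert, Finset.mem_singleton]
    rcases h with ⟨a, b⟩ | ⟨a, b⟩
    · left; exact Prod.ext (Subtype.ext a) (Subtype.ext b)
    · right; exact Prod.ext (Subtype.ext a) (Subtype.ext b))
  refine h1.trans (Nat.mul_le_mul_left 2 ?_)
  rw [← Set.ncard_coe_finset]
  refine Set.ncard_le_ncard ?_ ?_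
  · intro e he
    obtain ⟨p, hp, rfl⟩ := Finset.mem_image.mp (Finset.mem_coe.mp he)
    simp only [Xset, Finset.mem_filter, Finset.mem_product] at hp
    obtain ⟨⟨m1, m2⟩, hne, x, hx, hG⟩ := hp
    have m1' : p.1.1 ∈ Q := by simpa [sys] using m1
    have m2' : p.2.1 ∈ Q := by simpa [sys] using m2
    refine ⟨p.1.1, m1', p.2.1, m2', fun h => hne (Subtype.ext h), rfl, ?_⟩
    have g1 : y₀ < arcF p.1.1 x := (topCell_valid x₀ y₀ Q).J_gt hx
    have hG' : arcF p.1.1 x = arcF p.2.1 x := hG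
    have hmem : (!₂[x, arcF p.1.1 x] : Plane) ∈ ExtCell x₀ y₀ := by
      rw [← topCell_region x₀ y₀ Q]
      refine ⟨?_, ?_, ?_, ?_⟩
      · exact hx.1.le
      · exact hx.2.1.le
      · exact hx.2.2.1.le
      · exact hx.2.2.2.le
    refine ⟨!₂[x, arcF p.1.1 x], ⟨dist_arcF p.1.2 g1, hmem⟩, ?_, hmem⟩
    rw [hG'] at g1 ⊢
    exact dist_arcF p.2.2 g1
  · refine (((Q : Set Plane).toFinite.prod (Q : Set Plane).toFinite).image
      (fun p => ({p.1, p.2} : Set Plane))).subset ?_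
    rintro e ⟨q, hq, q', hq', -, rfl, -⟩
    exact ⟨(q, q'), ⟨hq, hq'⟩, rfl⟩

lemma children {T : Cell ι} (hv : Valid A T) {L : List (Cell ι)} (hL : Sub A T L)
    (F : Cell ι → List (Cell ι)) (hF : ∀ τ ∈ L, Sub A τ (F τ)) {σ : Cell ι} (hσ : σ ∈ L) :
    {s | s ∈ ((L.flatMap F).map (region A)).toFinset ∧ s ⊆ region A σ}.ncard ≤ (F σ).length := by
  have h1 : {s | s ∈ ((L.flatMap F).map (region A)).toFinset ∧ s ⊆ region A σ} ⊆
      (((F σ).map (region A)).toFinset : Set (Set Plane)) := by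
    rintro s ⟨hs, hsub⟩
    obtain ⟨τ, hτ, rfl⟩ := List.mem_map.mp (List.mem_toFinset.mp hs)
    obtain ⟨σ', hσ', hτ'⟩ := List.mem_flatMap.mp hτ
    have hτv : Valid A τ := (hF σ' hσ').valid (hL.valid hv σ' hσ') τ hτ'
    have heq : σ = σ' := by
      by_contra hne
      have hd := hL.disj' hv hσ hσ' hne
      obtain ⟨z, hz⟩ := oreg_nonempty hτv
      have a1 : z ∈ oreg A σ' := ((hF σ' hσ').region_sub (hL.valid hv σ' hσ')).2 τ hτ' hz
      have a2 : z ∈ oreg A σ :=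
        interior_sub_oreg σ (interior_mono hsub (oreg_sub_interior τ hz))
      exact Set.disjoint_left.mp hd a2 a1
    subst heq
    rw [Finset.mem_coe, List.mem_toFinset]
    exact List.mem_map_of_mem hτ'
  refine (Set.ncard_le_ncard h1 (Finset.finite_toSet _)).trans ?_
  rw [Set.ncard_coe_finset]
  exact (List.toFinset_card_le _).trans (by rw [List.length_map])

end Cut

/-- **Cutting Theorem** (existence part of Theorem 2.2). For every `δ > 0`
there are constants `ρ ≥ 2` and `c > 0` such that for every configuration of
squares `C` (below `y = y₀`) and `C'`, every set `Q ⊆ C` of `n` points with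
nonempty upper arcs, and every `1 ≤ r ≤ n`, there is a hierarchical
`(1/r)`-cutting `Ξ₀, …, Ξ_k` (with `k = ⌈log_ρ r⌉`) for the arcs `{h_q}`:
`Ξ₀ = {T}`; each `Ξᵢ` is a collection of interior-disjoint pseudo-trapezoids
covering `T`; each member of `Ξᵢ` is contained in a member of `Ξ_{i−1}`, which
in turn contains at most `c` members of `Ξᵢ`; the interior of each member of
`Ξᵢ` is crossed by at most `n/ρ^i` of the arcs; and the total size is at most
`c·(r^{1+δ} + χ·r²/n²)`, where `χ` is the number of crossing pairs of arcs. -/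
theorem cutting_theorem (δ : ℝ) (hδ : 0 < δ) :
    ∃ ρ : ℝ, 2 ≤ ρ ∧ ∃ c : ℝ, 0 < c ∧
      ∀ x₀ y₀ x₁ y₁ : ℝ, y₁ + gs ≤ y₀ →
      ∀ Q : Finset Plane, (∀ q ∈ Q, q ∈ Square x₁ y₁) →
      (∀ q ∈ Q, (UpperArc x₀ y₀ q).Nonempty) →
      ∀ r : ℝ, 1 ≤ r → r ≤ (Q.card : ℝ) →
      ∃ Ξ : ℕ → Finset (Set Plane),
        let n : ℝ := (Q.card : ℝ)
        let χ : ℝ := (({e : Set Plane | ∃ q ∈ Q, ∃ q' ∈ Q, q ≠ q' ∧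
          e = {q, q'} ∧
          (UpperArc x₀ y₀ q ∩ UpperArc x₀ y₀ q').Nonempty}.ncard : ℕ) : ℝ)
        let k : ℕ := ⌈Real.logb ρ r⌉₊
        -- (i) the zeroth cutting is the single cell T
        Ξ 0 = {ExtCell x₀ y₀} ∧
        -- each Ξᵢ consists of pseudo-trapezoids
        (∀ i ≤ k, ∀ σ ∈ Ξ i, IsPseudoTrapezoid x₀ y₀ σ) ∧
        -- (ii) interior-disjointness and covering of T
        (∀ i ≤ k, ∀ σ ∈ Ξ i, ∀ σ' ∈ Ξ i, σ ≠ σ' →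
          interior σ ∩ interior σ' = ∅) ∧
        (∀ i ≤ k, ⋃ σ ∈ Ξ i, σ = ExtCell x₀ y₀) ∧
        -- (iii) hierarchical refinement with at most c children per cell
        (∀ i, 1 ≤ i → i ≤ k →
          (∀ σ' ∈ Ξ i, ∃ σ ∈ Ξ (i - 1), σ' ⊆ σ) ∧
          (∀ σ ∈ Ξ (i - 1),
            ({σ' : Set Plane | σ' ∈ Ξ i ∧ σ' ⊆ σ}.ncard : ℝ) ≤ c)) ∧
        -- (iv) each cell of Ξᵢ is crossed by at most n/ρ^i arcs
        (∀ i ≤ k, ∀ σ ∈ Ξ i,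
          ({q : Plane | q ∈ Q ∧
            (UpperArc x₀ y₀ q ∩ interior σ).Nonempty}.ncard : ℝ) ≤
              n / ρ ^ (i : ℝ)) ∧
        -- (v) total size bound
        ((∑ i ∈ Finset.range (k + 1), ((Ξ i).card : ℝ)) ≤
          c * (r ^ ((1 : ℝ) + δ) + χ * r ^ 2 / n ^ 2)) := by
  obtain ⟨ρ, θ, a, D, hρ, hθ, hθρ, hθD, hD, ha, ha2, ha3, haρ⟩ := Cut.constants δ hδ
  have hρ0 : 0 < ρ := by linarith
  have ha0 : 0 < a := by linarith
  refine ⟨ρ, hρ, 2 * ρ ^ (1 + δ) + 128 * a / θ * ρ ^ 2 + a * (1 + 16 * ρ ^ 2 / θ),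
    by positivity, ?_⟩
  intro x₀ y₀ x₁ y₁ hy Q hQ _ r hr hrn
  have hn : (0 : ℝ) < Q.card := by linarith
  have hcard := Cut.sys_card hy hQ
  have hQy : ∀ q ∈ Q, q 1 ≤ y₀ := fun q hq => (hQ q hq).2.2.2.trans hy
  have hv := Cut.topCell_valid x₀ y₀ Q
  have hreg := Cut.topCell_region x₀ y₀ Q
  obtain ⟨F, Λ, hΛ0, hΛs, hsub, hM, hF, hlen⟩ := Cut.hierarchy (A := Cut.sys y₀ Q) ρ θ hρ hθ hθρ D
    hθD hD a ha ha2 (Q.card : ℝ) hn (Cut.topCell x₀ y₀) hv (by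
      rw [← hcard]; exact_mod_cast Cut.M_le_card _)
  have hmem : ∀ i (s : Set Plane), s ∈ ((Λ i).map (Cut.region (Cut.sys y₀ Q))).toFinset ↔
      ∃ τ ∈ Λ i, Cut.region (Cut.sys y₀ Q) τ = s := by
    intro i s
    rw [List.mem_toFinset, List.mem_map]
  have hin : ∀ i, ∀ τ ∈ Λ i, Cut.region (Cut.sys y₀ Q) τ ⊆ ExtCell x₀ y₀ := by
    intro i τ hτ
    rw [← hreg]
    exact ((hsub i).region_sub hv).1 τ hτ
  refine ⟨fun i => ((Λ i).map (Cut.region (Cut.sys y₀ Q))).toFinset, ?_⟩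
  intro n χ k
  refine ⟨?_, ?_, ?_, ?_, ?_, ?_, ?_⟩
  · simp [hΛ0, hreg]
  · intro i _ σ hσ
    obtain ⟨τ, hτ, rfl⟩ := (hmem i σ).mp hσ
    exact Cut.region_trap ((hsub i).valid hv τ hτ) (hin i τ hτ)
  · intro i _ σ hσ σ' hσ' hne
    obtain ⟨τ, hτ, rfl⟩ := (hmem i σ).mp hσ
    obtain ⟨τ', hτ', rfl⟩ := (hmem i σ').mp hσ'
    have hd := (hsub i).disj' hv hτ hτ' (fun h => hne (by rw [h]))
    rw [← Set.disjoint_iff_inter_eq_empty]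
    exact hd.mono (Cut.interior_sub_oreg τ) (Cut.interior_sub_oreg τ')
  · intro i _
    apply Set.Subset.antisymm
    · refine Set.iUnion₂_subset (fun σ hσ => ?_)
      obtain ⟨τ, hτ, rfl⟩ := (hmem i σ).mp hσ
      exact hin i τ hτ
    · intro z hz
      rw [← hreg] at hz
      obtain ⟨τ, hτ, hzτ⟩ := (hsub i).cover z hz
      exact Set.mem_iUnion₂.mpr ⟨_, (hmem i _).mpr ⟨τ, hτ, rfl⟩, hzτ⟩
  · intro i hi1 _
    obtain ⟨j, rfl⟩ : ∃ j, i = j + 1 := ⟨i - 1, by omega⟩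
    rw [Nat.add_sub_cancel]
    constructor
    · intro σ' hσ'
      obtain ⟨τ, hτ, rfl⟩ := (hmem _ σ').mp hσ'
      rw [hΛs] at hτ
      obtain ⟨s, hs, hτs⟩ := List.mem_flatMap.mp hτ
      exact ⟨_, (hmem j _).mpr ⟨s, hs, rfl⟩,
        ((hF j s hs).1.region_sub ((hsub j).valid hv s hs)).1 τ hτs⟩
    · intro σ hσ
      obtain ⟨s, hs, rfl⟩ := (hmem j σ).mp hσ
      have h1 := Cut.children hv (hsub j) (F j) (fun τ hτ => (hF j τ hτ).1) hs
      rw [← hΛs] at h1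
      have h2 := (hF j s hs).2
      refine le_trans (Nat.cast_le.mpr h1) (h2.trans ?_)
      have : 0 ≤ 2 * ρ ^ (1 + δ) + 128 * a / θ * ρ ^ 2 := by positivity
      linarith
  · intro i _ σ hσ
    obtain ⟨τ, hτ, rfl⟩ := (hmem i σ).mp hσ
    rw [Real.rpow_natCast]
    exact le_trans (Nat.cast_le.mpr (Cut.crossed_le hQy τ)) (hM i τ hτ)
  · have hS := Cut.sum_bound a ρ
      (16 * a / θ * ((Cut.Xset (Cut.sys y₀ Q) (Cut.topCell x₀ y₀)).card : ℝ) / (Q.card : ℝ) ^ 2)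
      ha3 hρ (by positivity)
      (fun i => ((((Λ i).map (Cut.region (Cut.sys y₀ Q))).toFinset.card : ℕ) : ℝ)) (fun i => by
        refine le_trans (Nat.cast_le.mpr ((List.toFinset_card_le _).trans_eq
          (List.length_map _))) (hlen i)) k
    refine Cut.final_bound δ ρ θ a r _ χ n _ k hδ hρ hθ ha3 haρ hr (Cut.k_bound ρ r hρ hr) ?_
      (Nat.cast_nonneg _) hn hS
    have h := Cut.X_le_chi x₀ y₀ Q
    simp only [χ]
    exact_mod_cast h
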